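/- arXiv:1811.01230 — 2 statements merged into one kernel-verified Lean document; each statement's English description precedes it below -/
import Mathlib

section
/- Let R be an arithmetical ring and n ≥ 3. Then SLₙ(R[x]) = SLₙ(R) · Eₙ(R[x]), i.e., every σ(x) ∈ SLₙ(R[x]) factors as σ(0) times an element of Eₙ(R[x]). -/
open Matrix Polynomial

/-- The set of elementary matrices (transvections) over a commutative ring. -/
def ElemSet (ι R : Type) [Fintype ι] [DecidableEq ι] [CommRing R] :
    Set (Matrix ι ι R) :=
  { M | ∃ i j : ι, ∃ a : R, i ≠ j ∧ M = Matrix.transvection i j a }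

/-- The elementary subgroup `E_n(R)`, as the multiplicative closure of the
elementary matrices (it is closed under inverses, hence a group). -/
def Elem (ι R : Type) [Fintype ι] [DecidableEq ι] [CommRing R] :
    Submonoid (Matrix ι ι R) :=
  Submonoid.closure (ElemSet ι R)

/-- A row is unimodular if its entries generate the unit ideal. -/
def IsUnimodular {ι R : Type} [CommRing R] (v : ι → R) : Prop :=
  Ideal.span (Set.range v) = ⊤

/-- Two rows are equivalent under the elementary group if one is obtained from
the other by right multiplication by an element of `E_n(R)`. -/
def RowEquivE {ι R : Type} [Fintype ι] [DecidableEq ι] [CommRing R]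
    (v w : ι → R) : Prop :=
  ∃ E ∈ Elem ι R, Matrix.vecMul v E = w

namespace ElementaryPolynomial

open Matrix.SpecialLinearGroup (transvection)

section Elementary

variable {ι R B : Type} [Fintype ι] [DecidableEq ι] [CommRing R] [CommRing B]

/-- The elementary subgroup of the special linear group. -/
def elementarySL (ι R : Type) [Fintype ι] [DecidableEq ι] [CommRing R] :
    Subgroup (SpecialLinearGroup ι R) :=
  Subgroup.closure { M | ∃ (i j : ι) (h : i ≠ j) (a : R), M = transvection h a }

lemma transvection_mem {i j : ι} (h : i ≠ j) (a : R) : transvection h a ∈ elementarySL ι R :=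
  Subgroup.subset_closure ⟨i, j, h, a, rfl⟩

lemma elementarySL_induction {P : SpecialLinearGroup ι R → Prop}
    (hgen : ∀ (i j : ι) (h : i ≠ j) (a : R), P (transvection h a)) (one : P 1)
    (mul : ∀ x y, x ∈ elementarySL ι R → y ∈ elementarySL ι R → P x → P y → P (x * y))
    {x : SpecialLinearGroup ι R} (hx : x ∈ elementarySL ι R) : P x := by
  refine Subgroup.closure_induction'' (p := fun x _ => P x) ?_ ?_ one mul hx
  · rintro _ ⟨i, j, h, a, rfl⟩
    exact hgen i j h a
  · rintro _ ⟨i, j, h, a, rfl⟩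
    rw [SpecialLinearGroup.transvection_inv]
    exact hgen i j h _

lemma coe_mem_Elem {x : SpecialLinearGroup ι R} (hx : x ∈ elementarySL ι R) :
    (x : Matrix ι ι R) ∈ Elem ι R := by
  refine elementarySL_induction (P := fun x => (x : Matrix ι ι R) ∈ Elem ι R) ?_ ?_ ?_ hx
  · exact fun i j h a => Submonoid.subset_closure ⟨i, j, a, h, rfl⟩
  · exact one_mem _
  · exact fun x y _ _ hx hy => mul_mem hx hy

lemma map_transvection (φ : R →+* B) {i j : ι} (h : i ≠ j) (a : R) :
    SpecialLinearGroup.map φ (transvection h a) = transvection h (φ a) := by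
  ext k l
  simp only [SpecialLinearGroup.map_apply_coe, RingHom.mapMatrix_apply, Matrix.map_apply,
    SpecialLinearGroup.transvection_coe, Matrix.add_apply, map_add, Matrix.single_apply,
    Matrix.one_apply]
  split_ifs <;> simp

lemma map_mem_elementarySL (φ : R →+* B) {x : SpecialLinearGroup ι R}
    (hx : x ∈ elementarySL ι R) : SpecialLinearGroup.map φ x ∈ elementarySL ι B := by
  refine elementarySL_induction (P := fun x => SpecialLinearGroup.map φ x ∈ elementarySL ι B)
    ?_ ?_ ?_ hx
  · intro i j h a
    rw [map_transvection]
    exact transvection_mem h _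
  · rw [map_one]
    exact one_mem _
  · intro x y _ _ hx hy
    rw [map_mul]
    exact mul_mem hx hy

lemma map_comp_apply {D : Type} [CommRing D] (φ : R →+* B) (ψ : B →+* D)
    (x : SpecialLinearGroup ι R) :
    SpecialLinearGroup.map ψ (SpecialLinearGroup.map φ x) =
      SpecialLinearGroup.map (ψ.comp φ) x := by
  ext k l
  simp

/-- Steinberg relation for `e_{kl}(b) e_{li}(c)`. -/
lemma transvection_conj_left {k l j : ι} (hkl : k ≠ l) (hlj : l ≠ j) (hkj : k ≠ j) (b c : R) :
    transvection hkl b * transvection hlj c * (transvection hkl b)⁻¹ =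
      transvection hkj (b * c) * transvection hlj c := by
  rw [mul_inv_eq_iff_eq_mul]
  apply Subtype.ext
  change Matrix.transvection k l b * Matrix.transvection l j c =
    Matrix.transvection k j (b * c) * Matrix.transvection l j c * Matrix.transvection k l b
  simp only [Matrix.transvection, mul_add, add_mul,
    mul_one, one_mul, Matrix.single_mul_single_same,
    Matrix.single_mul_single_of_ne _ _ _ _ hkj.symm,
    Matrix.single_mul_single_of_ne _ _ _ _ hlj.symm, zero_mul]
  abel

/-- Steinberg relation for `e_{kl}(b) e_{ik}(c)`. -/
lemma transvection_conj_right {k l i : ι} (hkl : k ≠ l) (hik : i ≠ k) (hil : i ≠ l) (b c : R) :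
    transvection hkl b * transvection hik c * (transvection hkl b)⁻¹ =
      transvection hil (-(c * b)) * transvection hik c := by
  rw [mul_inv_eq_iff_eq_mul]
  apply Subtype.ext
  change Matrix.transvection k l b * Matrix.transvection i k c =
    Matrix.transvection i l (-(c * b)) * Matrix.transvection i k c * Matrix.transvection k l b
  simp only [Matrix.transvection, mul_add, add_mul,
    mul_one, one_mul, Matrix.single_mul_single_same, ← Matrix.single_neg,
    Matrix.single_mul_single_of_ne _ _ _ _ hil.symm, neg_mul, zero_mul,
    Matrix.single_mul_single_of_ne _ _ _ _ hkl.symm]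
  abel

lemma transvection_conj_of_ne {k l i j : ι} (hkl : k ≠ l) (hij : i ≠ j) (hli : l ≠ i)
    (hjk : j ≠ k) (b c : R) :
    transvection hkl b * transvection hij c * (transvection hkl b)⁻¹ = transvection hij c := by
  rw [mul_inv_eq_iff_eq_mul]
  apply Subtype.ext
  change Matrix.transvection k l b * Matrix.transvection i j c =
    Matrix.transvection i j c * Matrix.transvection k l b
  simp only [Matrix.transvection, mul_add, add_mul,
    mul_one, one_mul, Matrix.single_mul_single_of_ne _ _ _ _ hli,
    Matrix.single_mul_single_of_ne _ _ _ _ hjk]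
  abel

lemma transvection_eq_commutator {i p j : ι} (hip : i ≠ p) (hpj : p ≠ j) (hij : i ≠ j) (b c : R) :
    transvection hij (b * c) = transvection hip b * transvection hpj c *
      (transvection hip b)⁻¹ * (transvection hpj c)⁻¹ := by
  rw [transvection_conj_left hip hpj hij, mul_inv_cancel_right]

end Elementary

section Conjugation

variable {ι A B : Type} [Fintype ι] [DecidableEq ι] [CommRing A] [CommRing B]

/-- The subgroup of `SL(B)` generated by transvections with coefficients in the image of `s A`. -/
def scaledElementary (ι : Type) [Fintype ι] [DecidableEq ι] (φ : A →+* B) (s : A) :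
    Subgroup (SpecialLinearGroup ι B) :=
  Subgroup.closure { M | ∃ (i j : ι) (h : i ≠ j) (a : A), M = transvection h (φ (s * a)) }

lemma transvection_mem_scaled (φ : A →+* B) (s : A) {i j : ι} (h : i ≠ j) (a : A) :
    transvection h (φ (s * a)) ∈ scaledElementary ι φ s :=
  Subgroup.subset_closure ⟨i, j, h, a, rfl⟩

lemma conj_transvection_mem_of_not_opposite (φ : A →+* B) {k l i j : ι} (hkl : k ≠ l)
    (hij : i ≠ j) (hopp : ¬ (l = i ∧ j = k)) {b : B} {u a : A} (hu : φ u * b = φ a) (s c : A) :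
    transvection hkl b * transvection hij (φ (u * s * c)) * (transvection hkl b)⁻¹ ∈
      scaledElementary ι φ s := by
  have h0 : transvection hij (φ (u * s * c)) ∈ scaledElementary ι φ s := by
    rw [show u * s * c = s * (u * c) by ring]
    exact transvection_mem_scaled φ s hij _
  by_cases hli : l = i
  · subst hli
    have hkj : k ≠ j := fun h => hopp ⟨rfl, h.symm⟩
    rw [transvection_conj_left hkl hij hkj]
    refine mul_mem ?_ h0
    rw [show b * φ (u * s * c) = φ (s * (a * c)) by
      simp only [map_mul, ← hu]
      ring]
    exact transvection_mem_scaled φ s hkj _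
  · by_cases hjk : j = k
    · subst hjk
      rw [transvection_conj_right hkl hij (Ne.symm hli)]
      refine mul_mem ?_ h0
      rw [show -(φ (u * s * c) * b) = φ (s * (-(a * c))) by
        simp only [map_mul, map_neg, ← hu]
        ring]
      exact transvection_mem_scaled φ s _ _
    · rw [transvection_conj_of_ne hkl hij hli hjk]
      exact h0

/-- Conjugation by an elementary matrix with denominators in `S` maps a sufficiently scaled
elementary subgroup into a prescribed one. -/
lemma exists_conj_scaled_mem (hι : ∀ i j : ι, ∃ p, p ≠ i ∧ p ≠ j) (φ : A →+* B)
    (S : Submonoid A) (hS : ∀ b : B, ∃ u ∈ S, ∃ a, φ u * b = φ a)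
    {γ : SpecialLinearGroup ι B} (hγ : γ ∈ elementarySL ι B) :
    ∀ s ∈ S, ∃ t ∈ S, ∀ h ∈ scaledElementary ι φ t, γ * h * γ⁻¹ ∈ scaledElementary ι φ s := by
  refine elementarySL_induction (P := fun γ => ∀ s ∈ S, ∃ t ∈ S, ∀ h ∈ scaledElementary ι φ t,
    γ * h * γ⁻¹ ∈ scaledElementary ι φ s) ?_ ?_ ?_ hγ
  · intro k l hkl b s hs
    obtain ⟨u, hu, a, ha⟩ := hS b
    refine ⟨u * s * (u * s), mul_mem (mul_mem hu hs) (mul_mem hu hs), fun h hh => ?_⟩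
    have key : ∀ {i j : ι} (hij : i ≠ j) (c : A), transvection hkl b *
        transvection hij (φ (u * s * (u * s) * c)) * (transvection hkl b)⁻¹ ∈
        scaledElementary ι φ s := by
      intro i j hij c
      by_cases hopp : l = i ∧ j = k
      · obtain ⟨rfl, rfl⟩ := hopp
        obtain ⟨p, hpl, hpj⟩ := hι l j
        rw [show u * s * (u * s) * c = u * s * 1 * (u * s * c) by ring, map_mul,
          transvection_eq_commutator hpl.symm hpj hij]
        have h1 := conj_transvection_mem_of_not_opposite φ hkl hpl.symm
          (fun h => hpj h.2) ha s 1
        have h2 := conj_transvection_mem_of_not_opposite φ hkl hpj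
          (fun h => hpl h.1.symm) ha s c
        convert! mul_mem (mul_mem (mul_mem h1 h2) (inv_mem h1)) (inv_mem h2) using 1
        group
      · rw [mul_assoc (u * s)]
        exact conj_transvection_mem_of_not_opposite φ hkl hij hopp ha s _
    have hle : scaledElementary ι φ (u * s * (u * s)) ≤
        (scaledElementary ι φ s).comap (MulAut.conj (transvection hkl b)).toMonoidHom := by
      refine (Subgroup.closure_le _).2 ?_
      rintro _ ⟨i, j, hij, c, rfl⟩
      exact key hij c
    exact hle hh
  · intro s hs
    exact ⟨s, hs, fun h hh => by simpa using hh⟩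
  · intro x y _ _ hx hy s hs
    obtain ⟨t, ht, hxt⟩ := hx s hs
    obtain ⟨r, hr, hyr⟩ := hy t ht
    refine ⟨r, hr, fun h hh => ?_⟩
    have := hxt _ (hyr h hh)
    rwa [_root_.mul_inv_rev, show x * y * h * (y⁻¹ * x⁻¹) = x * (y * h * y⁻¹) * x⁻¹ by group]

end Conjugation

section Localization

variable {ι A B : Type} [Fintype ι] [DecidableEq ι] [CommRing A] [CommRing B]

/-- The substitution `X ↦ s X`. -/
noncomputable def dilation (s : A) : A[X] →+* A[X] := compRingHom (C s * X)

/-- The endomorphism `p ↦ p(0)` of the polynomial ring. -/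
noncomputable def constantPart (A : Type) [CommRing A] : A[X] →+* A[X] :=
  C.comp (evalRingHom 0)

lemma coeff_dilation (s : A) (p : A[X]) (n : ℕ) :
    (dilation s p).coeff n = p.coeff n * s ^ n := by
  simp [dilation]

lemma constantPart_apply (p : A[X]) : constantPart A p = C (p.coeff 0) := by
  simp [constantPart, coeff_zero_eq_eval_zero]

lemma dilation_comp_dilation (s t : A) : (dilation s).comp (dilation t) = dilation (t * s) := by
  ext <;> simp [dilation, mul_assoc]

lemma constantPart_comp_constantPart :
    (constantPart A).comp (constantPart A) = constantPart A := by
  ext <;> simp [constantPart]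

lemma constantPart_comp_dilation (s : A) :
    (constantPart A).comp (dilation s) = constantPart A := by
  ext <;> simp [dilation, constantPart]

lemma map_comp_dilation (φ : A →+* B) (s : A) :
    (mapRingHom φ).comp (dilation s) = (dilation (φ s)).comp (mapRingHom φ) := by
  ext <;> simp [dilation]

lemma map_comp_constantPart (φ : A →+* B) :
    (mapRingHom φ).comp (constantPart A) = (constantPart B).comp (mapRingHom φ) := by
  ext <;> simp [constantPart]

attribute [local instance] Polynomial.algebra Polynomial.isLocalization in
lemma exists_polynomial_denominator [Algebra A B] (S : Submonoid A) [IsLocalization S B]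
    (p : B[X]) : ∃ u ∈ S, ∃ a : A[X], C (algebraMap A B u) * p = a.map (algebraMap A B) := by
  obtain ⟨⟨a, ⟨_, u, hu, rfl⟩⟩, h⟩ := IsLocalization.surj (S.map (C : A →+* A[X])) p
  refine ⟨u, hu, a, ?_⟩
  rw [mul_comm]
  simpa [Polynomial.algebraMap_def] using h

attribute [local instance] Polynomial.algebra Polynomial.isLocalization in
lemma exists_polynomial_annihilator [Algebra A B] (S : Submonoid A) [IsLocalization S B]
    (p : A[X]) (hp : p.map (algebraMap A B) = 0) : ∃ u ∈ S, C u * p = 0 := by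
  obtain ⟨⟨_, u, hu, rfl⟩, h⟩ :=
    (IsLocalization.map_eq_zero_iff (S.map (C : A →+* A[X])) B[X] p).1
      (by simpa [Polynomial.algebraMap_def] using hp)
  exact ⟨u, hu, h⟩

lemma exists_dilation_mem_scaled (hι : ∀ i j : ι, ∃ p, p ≠ i ∧ p ≠ j) [Algebra A B]
    (S : Submonoid A) [IsLocalization S B] {α : SpecialLinearGroup ι B[X]}
    (hα : α ∈ elementarySL ι B[X]) :
    ∀ s₀ ∈ S, ∃ s ∈ S, ∀ r ∈ S,
      SpecialLinearGroup.map (dilation (algebraMap A B (r * s))) α *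
        (SpecialLinearGroup.map (constantPart B) α)⁻¹ ∈
          scaledElementary ι (mapRingHom (algebraMap A B)) (C s₀) := by
  refine elementarySL_induction (P := fun α => ∀ s₀ ∈ S, ∃ s ∈ S, ∀ r ∈ S,
      SpecialLinearGroup.map (dilation (algebraMap A B (r * s))) α *
        (SpecialLinearGroup.map (constantPart B) α)⁻¹ ∈
          scaledElementary ι (mapRingHom (algebraMap A B)) (C s₀)) ?_ ?_ ?_ hα
  · intro i j hij p s₀ hs₀
    obtain ⟨u, hu, a, ha⟩ := exists_polynomial_denominator S p.divX
    refine ⟨s₀ * u, mul_mem hs₀ hu, fun r _ => ?_⟩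
    rw [map_transvection, map_transvection, SpecialLinearGroup.transvection_inv,
      ← SpecialLinearGroup.transvection_add]
    convert! transvection_mem_scaled _ _ hij (C r * X * dilation (r * (s₀ * u)) a) using 2
    have h1 : p = divX p * X + C (p.coeff 0) := (divX_mul_X_add p).symm
    have h2 := congrArg (dilation (algebraMap A B (r * (s₀ * u)))) ha
    have h3 := RingHom.congr_fun (map_comp_dilation (algebraMap A B) (r * (s₀ * u))) a
    simp only [RingHom.comp_apply, coe_mapRingHom] at h3
    rw [← h3] at h2
    simp only [map_mul, coe_mapRingHom, map_C, map_X] at h2 ⊢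
    rw [← h2, constantPart_apply]
    nth_rw 1 [h1]
    simp only [dilation, map_add, map_mul, coe_compRingHom_apply, C_comp, X_comp]
    ring
  · intro s₀ hs₀
    exact ⟨s₀, hs₀, fun r _ => by simp⟩
  · intro x y hx _ ihx ihy s₀ hs₀
    obtain ⟨t, ht, hconj⟩ := exists_conj_scaled_mem hι (mapRingHom (algebraMap A B))
      (S.map (C : A →+* A[X])) (by
        intro b
        obtain ⟨u, hu, a, ha⟩ := exists_polynomial_denominator S b
        exact ⟨C u, ⟨u, hu, rfl⟩, a, by simpa using ha⟩)
      (map_mem_elementarySL (constantPart B) hx) (C s₀) ⟨s₀, hs₀, rfl⟩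
    obtain ⟨t, htS, rfl⟩ := ht
    obtain ⟨s₁, hs₁, h₁⟩ := ihx s₀ hs₀
    obtain ⟨s₂, hs₂, h₂⟩ := ihy t htS
    refine ⟨s₁ * s₂, mul_mem hs₁ hs₂, fun r hr => ?_⟩
    have e₁ := h₁ (r * s₂) (mul_mem hr hs₂)
    have e₂ := hconj _ (h₂ (r * s₁) (mul_mem hr hs₁))
    rw [show r * s₂ * s₁ = r * (s₁ * s₂) by ring] at e₁
    rw [show r * s₁ * s₂ = r * (s₁ * s₂) by ring] at e₂
    convert! mul_mem e₁ e₂ using 1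
    rw [map_mul (SpecialLinearGroup.map (dilation _)),
      map_mul (SpecialLinearGroup.map (constantPart B))]
    group

/-- A matrix `τ(X)` with `τ(0) = 1` that becomes elementary after localization at `S` is elementary
after a substitution `X ↦ s X` with `s ∈ S`. -/
lemma exists_dilation_mem_elementarySL (hι : ∀ i j : ι, ∃ p, p ≠ i ∧ p ≠ j) [Algebra A B]
    (S : Submonoid A) [IsLocalization S B] {τ : SpecialLinearGroup ι A[X]}
    (hτ₀ : SpecialLinearGroup.map (constantPart A) τ = 1)
    (hτ : SpecialLinearGroup.map (mapRingHom (algebraMap A B)) τ ∈ elementarySL ι B[X]) :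
    ∃ s ∈ S, SpecialLinearGroup.map (dilation s) τ ∈ elementarySL ι A[X] := by
  obtain ⟨s, hs, h⟩ := exists_dilation_mem_scaled hι S hτ 1 (one_mem S)
  have h := h 1 (one_mem S)
  rw [map_comp_apply, map_comp_apply, one_mul, ← map_comp_dilation, ← map_comp_constantPart,
    ← map_comp_apply, ← map_comp_apply, hτ₀,
    map_one (SpecialLinearGroup.map (mapRingHom (algebraMap A B))), inv_one, mul_one] at h
  have hlift : scaledElementary ι (mapRingHom (algebraMap A B)) (C 1) ≤
      (elementarySL ι A[X]).map (SpecialLinearGroup.map (mapRingHom (algebraMap A B))) := by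
    refine (Subgroup.closure_le _).2 ?_
    rintro _ ⟨i, j, hij, a, rfl⟩
    exact ⟨transvection hij a, transvection_mem hij a, by rw [map_transvection, C_1, one_mul]⟩
  obtain ⟨E, hE, hEτ⟩ := hlift h
  set E₀ := E * (SpecialLinearGroup.map (constantPart A) E)⁻¹ with hE₀
  have hE₀mem : E₀ ∈ elementarySL ι A[X] :=
    mul_mem hE (inv_mem (map_mem_elementarySL _ hE))
  have hE₀const : SpecialLinearGroup.map (constantPart A) E₀ = 1 := by
    rw [hE₀, map_mul, map_inv, map_comp_apply, constantPart_comp_constantPart, mul_inv_cancel]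
  have hE₀τ : SpecialLinearGroup.map (mapRingHom (algebraMap A B)) E₀ =
      SpecialLinearGroup.map (mapRingHom (algebraMap A B))
        (SpecialLinearGroup.map (dilation s) τ) := by
    rw [hE₀, map_mul, map_inv, hEτ, map_comp_apply (constantPart A), map_comp_constantPart,
      ← map_comp_apply, hEτ, map_comp_apply _ (constantPart B), ← map_comp_constantPart,
      map_comp_apply _ ((mapRingHom (algebraMap A B)).comp (constantPart A)), RingHom.comp_assoc,
      constantPart_comp_dilation, ← map_comp_apply (constantPart A), hτ₀, map_one, inv_one, mul_one]
  have hann : ∀ i j : ι, ∃ u ∈ S,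
      C u * (E₀ i j - SpecialLinearGroup.map (dilation s) τ i j) = 0 := by
    intro i j
    apply exists_polynomial_annihilator (B := B) S
    have := congrFun (congrFun (congrArg Subtype.val hE₀τ) i) j
    simp only [SpecialLinearGroup.map_apply_coe, RingHom.mapMatrix_apply, Matrix.map_apply,
      coe_mapRingHom] at this
    rw [Polynomial.map_sub, sub_eq_zero, this]
    simp
  choose u hu hann using hann
  have hprod : ∏ i, ∏ j, u i j ∈ S := prod_mem fun i _ => prod_mem fun j _ => hu i j
  refine ⟨s * ∏ i, ∏ j, u i j, mul_mem hs hprod, ?_⟩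
  have key : SpecialLinearGroup.map (dilation (∏ i, ∏ j, u i j)) E₀ =
      SpecialLinearGroup.map (dilation (s * ∏ i, ∏ j, u i j)) τ := by
    rw [← dilation_comp_dilation, ← map_comp_apply]
    ext i j n
    simp only [SpecialLinearGroup.map_apply_coe, RingHom.mapMatrix_apply, Matrix.map_apply,
      coeff_dilation]
    rcases n with _ | n
    · have h1 := congrFun (congrFun (congrArg Subtype.val hE₀const) i) j
      have h2 := congrFun (congrFun (congrArg Subtype.val hτ₀) i) j
      rw [← h2] at h1
      simp only [SpecialLinearGroup.map_apply_coe, RingHom.mapMatrix_apply, Matrix.map_apply,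
        constantPart_apply] at h1
      simp [C_injective h1]
    · have h1 := congrArg (fun p => p.coeff (n + 1)) (hann i j)
      simp only [coeff_C_mul, coeff_sub, coeff_zero, SpecialLinearGroup.map_apply_coe,
        RingHom.mapMatrix_apply, Matrix.map_apply, coeff_dilation] at h1
      obtain ⟨v, hv⟩ : u i j ∣ ∏ i, ∏ j, u i j :=
        (Finset.dvd_prod_of_mem (u i) (Finset.mem_univ j)).trans
          (Finset.dvd_prod_of_mem (fun i => ∏ j, u i j) (Finset.mem_univ i))
      rw [hv, pow_succ, ← sub_eq_zero]
      linear_combination (u i j * v) ^ n * v * h1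
  rw [← key]
  exact map_mem_elementarySL _ hE₀mem

end Localization

section Patching

variable {ι R : Type} [Fintype ι] [DecidableEq ι] [CommRing R]

/-- The substitution `X ↦ Y + Z` into polynomials in `Z` over `R[Y]`. -/
noncomputable def addHom (R : Type) [CommRing R] : R[X] →+* R[X][X] :=
  eval₂RingHom (C.comp C) (C X + X)

lemma constantPart_comp_addHom : (constantPart R[X]).comp (addHom R) = C := by
  ext <;> simp [addHom, constantPart]

lemma constantPart_comp_C : (constantPart R).comp C = C := by
  ext; simp [constantPart]

lemma map_comp_addHom {B : Type} [CommRing B] (φ : R →+* B) :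
    (mapRingHom (mapRingHom φ)).comp (addHom R) = (addHom B).comp (mapRingHom φ) := by
  ext <;> simp [addHom]

lemma map_comp_C {B : Type} [CommRing B] (φ : R →+* B) :
    (mapRingHom φ).comp C = C.comp φ := by
  ext; simp

/-- The substitution `Y ↦ b X`, `Z ↦ c X`. -/
noncomputable def lineHom (b c : R) : R[X][X] →+* R[X] :=
  eval₂RingHom (dilation b) (C c * X)

lemma lineHom_comp_addHom (s b c : R) :
    ((lineHom b c).comp (dilation (C s))).comp (addHom R) = dilation (b + s * c) := by
  ext <;> simp [lineHom, dilation, addHom, add_mul, mul_assoc]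

lemma lineHom_comp_C (s b c : R) :
    ((lineHom b c).comp (dilation (C s))).comp C = dilation b := by
  ext <;> simp [lineHom, dilation]

/-- The scalars `s` such that `σ((b + s c) X) σ(b X)⁻¹` is elementary for all `b` and `c`. -/
noncomputable def patchingIdeal (σ : SpecialLinearGroup ι R[X]) : Ideal R where
  carrier := { s | ∀ b c : R, SpecialLinearGroup.map (dilation (b + s * c)) σ *
    (SpecialLinearGroup.map (dilation b) σ)⁻¹ ∈ elementarySL ι R[X] }
  zero_mem' b c := by simp
  add_mem' {s t} hs ht b c := by
    convert! mul_mem (ht (b + s * c) c) (hs b c) using 1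
    rw [show b + (s + t) * c = b + s * c + t * c by ring]
    group
  smul_mem' r s hs b c := by
    convert! hs b (r * c) using 4
    rw [smul_eq_mul]
    ring_nf

attribute [local instance] Polynomial.algebra Polynomial.isLocalization in
lemma exists_mem_patchingIdeal (hι : ∀ i j : ι, ∃ p, p ≠ i ∧ p ≠ j) (S : Submonoid R)
    {B : Type} [CommRing B] [Algebra R B] [IsLocalization S B] (σ : SpecialLinearGroup ι R[X])
    (hσ : SpecialLinearGroup.map (mapRingHom (algebraMap R B)) σ ∈ elementarySL ι B[X]) :
    ∃ s ∈ S, s ∈ patchingIdeal σ := by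
  obtain ⟨_, ⟨s, hs, rfl⟩, h⟩ := exists_dilation_mem_elementarySL hι (B := B[X])
    (S.map (C : R →+* R[X]))
    (τ := SpecialLinearGroup.map (addHom R) σ * (SpecialLinearGroup.map C σ)⁻¹)
    (by rw [map_mul, map_inv, map_comp_apply, map_comp_apply, constantPart_comp_addHom,
          constantPart_comp_C, mul_inv_cancel])
    (by
      rw [Polynomial.algebraMap_def, map_mul, map_inv, map_comp_apply, map_comp_apply,
        map_comp_addHom, map_comp_C, ← map_comp_apply, ← map_comp_apply]
      exact mul_mem (map_mem_elementarySL _ hσ) (inv_mem (map_mem_elementarySL _ hσ)))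
  refine ⟨s, hs, fun b c => ?_⟩
  have := map_mem_elementarySL (lineHom b c) h
  rwa [map_comp_apply, map_mul, map_inv, map_comp_apply, map_comp_apply, lineHom_comp_addHom,
    lineHom_comp_C] at this

/-- Local-global principle: a matrix `σ(X)` with `σ(0) = 1` that is locally elementary
is elementary. -/
theorem mem_elementarySL_of_forall_isMaximal (hι : ∀ i j : ι, ∃ p, p ≠ i ∧ p ≠ j)
    {σ : SpecialLinearGroup ι R[X]} (hσ₀ : SpecialLinearGroup.map (constantPart R) σ = 1)
    (hσ : ∀ (m : Ideal R) [m.IsMaximal],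
      SpecialLinearGroup.map (mapRingHom (algebraMap R (Localization.AtPrime m))) σ ∈
        elementarySL ι (Localization.AtPrime m)[X]) :
    σ ∈ elementarySL ι R[X] := by
  have htop : patchingIdeal σ = ⊤ := by
    by_contra hne
    obtain ⟨m, hm, hle⟩ := Ideal.exists_le_maximal _ hne
    obtain ⟨s, hs, hsI⟩ := exists_mem_patchingIdeal hι m.primeCompl σ (hσ m)
    exact hs (hle hsI)
  have h1 : (1 : R) ∈ patchingIdeal σ := htop ▸ Submodule.mem_top
  have h := h1 0 1
  have hd0 : dilation (0 : R) = constantPart R := by ext <;> simp [dilation, constantPart]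
  have hd1 : dilation (1 : R) = RingHom.id _ := by ext <;> simp [dilation]
  rw [zero_add, one_mul, hd0, hd1, hσ₀, inv_one, mul_one] at h
  convert! h

end Patching

section Blocks

section Rows

variable {ι A : Type} [DecidableEq ι] [CommRing A]

/-- The matrix with rows `f e_a + g e_b` and `r e_a + s e_b` at `a` and `b`, equal to the identity
in the other rows. -/
def block (a b : ι) (f g r s : A) : Matrix ι ι A := fun i =>
  if i = a then f • Pi.single a 1 + g • Pi.single b 1
  else if i = b then r • Pi.single a 1 + s • Pi.single b 1 else Pi.single i 1

lemma block_apply_left (a b : ι) (f g r s : A) :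
    block a b f g r s a = f • Pi.single a 1 + g • Pi.single b 1 := by
  simp [block]

lemma block_apply_right {a b : ι} (h : a ≠ b) (f g r s : A) :
    block a b f g r s b = r • Pi.single a 1 + s • Pi.single b 1 := by
  simp [block, h.symm]

lemma block_apply_of_ne {a b i : ι} (ha : i ≠ a) (hb : i ≠ b) (f g r s : A) :
    block a b f g r s i = Pi.single i 1 := by
  simp [block, ha, hb]

end Rows

lemma mul_apply_row {ι A : Type} [Fintype ι] [CommRing A] (M N : Matrix ι ι A) (i : ι) :
    (M * N) i = M i ᵥ* N := rfl

variable {ι A : Type} [Fintype ι] [DecidableEq ι] [CommRing A]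

lemma transvection_apply_left {i j : ι} (h : i ≠ j) (t : A) :
    (transvection h t : Matrix ι ι A) i = Pi.single i 1 + t • Pi.single j 1 := by
  ext k
  simp [SpecialLinearGroup.transvection_coe, Matrix.single_apply, Matrix.one_apply,
    Pi.single_apply, eq_comm]

lemma transvection_apply_of_ne {i j k : ι} (h : i ≠ j) (t : A) (hk : k ≠ i) :
    (transvection h t : Matrix ι ι A) k = Pi.single k 1 := by
  ext l
  simp [SpecialLinearGroup.transvection_coe, Matrix.one_apply,
    Pi.single_apply, eq_comm, hk.symm]

lemma single_one_vecMul (N : Matrix ι ι A) (i : ι) : (Pi.single i 1 : ι → A) ᵥ* N = N i := by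
  simp [Matrix.row]

/-- The pair `(f, g)` is the upper row of an elementary `2 × 2` block. -/
def IsElementaryPair (ι : Type) {A : Type} [Fintype ι] [DecidableEq ι] [CommRing A]
    (f g : A) : Prop :=
  ∀ a b : ι, a ≠ b → ∃ r s : A, f * s - g * r = 1 ∧
    ∃ σ ∈ elementarySL ι A, (σ : Matrix ι ι A) = block a b f g r s

namespace IsElementaryPair

variable {f g : A}

lemma one_zero : IsElementaryPair ι (1 : A) 0 := by
  intro a b hab
  refine ⟨0, 1, by ring, 1, one_mem _, ?_⟩
  refine funext fun i => ?_
  by_cases ha : i = a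
  · subst ha
    rw [block_apply_left]
    ext j; simp [Matrix.one_apply, Pi.single_apply, eq_comm]
  by_cases hb : i = b
  · subst hb
    rw [block_apply_right hab]
    ext j; simp [Matrix.one_apply, Pi.single_apply, eq_comm]
  · rw [block_apply_of_ne ha hb]
    ext j; simp [Matrix.one_apply, Pi.single_apply, eq_comm]

lemma add_right (h : IsElementaryPair ι f g) (t : A) : IsElementaryPair ι f (g + t * f) := by
  intro a b hab
  obtain ⟨r, s, hdet, σ, hσ, e⟩ := h a b hab
  refine ⟨r, s + t * r, by linear_combination hdet, σ * transvection hab t,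
    mul_mem hσ (transvection_mem hab t), ?_⟩
  change (σ : Matrix ι ι A) * (transvection hab t : Matrix ι ι A) = _
  rw [e]
  refine funext fun i => ?_
  rw [mul_apply_row]
  by_cases ha : i = a
  · subst ha
    rw [block_apply_left, block_apply_left, add_vecMul, smul_vecMul, smul_vecMul,
      single_one_vecMul, single_one_vecMul, transvection_apply_left,
      transvection_apply_of_ne hab t hab.symm]
    module
  by_cases hb : i = b
  · subst hb
    rw [block_apply_right hab, block_apply_right hab, add_vecMul, smul_vecMul, smul_vecMul,
      single_one_vecMul, single_one_vecMul, transvection_apply_left,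
      transvection_apply_of_ne hab t hab.symm]
    module
  · rw [block_apply_of_ne ha hb, block_apply_of_ne ha hb, single_one_vecMul,
      transvection_apply_of_ne hab t ha]

lemma add_left (h : IsElementaryPair ι f g) (t : A) : IsElementaryPair ι (f + t * g) g := by
  intro a b hab
  obtain ⟨r, s, hdet, σ, hσ, e⟩ := h a b hab
  refine ⟨r + t * s, s, by linear_combination hdet, σ * transvection hab.symm t,
    mul_mem hσ (transvection_mem hab.symm t), ?_⟩
  change (σ : Matrix ι ι A) * (transvection hab.symm t : Matrix ι ι A) = _
  rw [e]
  refine funext fun i => ?_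
  rw [mul_apply_row]
  by_cases ha : i = a
  · subst ha
    rw [block_apply_left, block_apply_left, add_vecMul, smul_vecMul, smul_vecMul,
      single_one_vecMul, single_one_vecMul, transvection_apply_left,
      transvection_apply_of_ne hab.symm t hab]
    module
  by_cases hb : i = b
  · subst hb
    rw [block_apply_right hab, block_apply_right hab, add_vecMul, smul_vecMul, smul_vecMul,
      single_one_vecMul, single_one_vecMul, transvection_apply_left,
      transvection_apply_of_ne hab.symm t hab]
    module
  · rw [block_apply_of_ne ha hb, block_apply_of_ne ha hb, single_one_vecMul,
      transvection_apply_of_ne hab.symm t hb]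

lemma of_isUnit_right (hg : IsUnit g) (f : A) : IsElementaryPair ι f g := by
  obtain ⟨v, hv⟩ := hg.exists_left_inv
  have h1 := ((one_zero (ι := ι)).add_right g).add_left ((f - 1) * v)
  rw [zero_add, mul_one] at h1
  convert h1 using 1
  linear_combination (1 - f) * hv

lemma mul_right (hι : ∀ i j : ι, ∃ p, p ≠ i ∧ p ≠ j) {g₁ g₂ : A}
    (h₁ : IsElementaryPair ι f g₁) (h₂ : IsElementaryPair ι f g₂) :
    IsElementaryPair ι f (g₁ * g₂) := by
  intro a c hac
  obtain ⟨b, hba, hbc⟩ := hι a c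
  obtain ⟨r₁, s₁, d₁, α, hα, eα⟩ := h₁ a b hba.symm
  obtain ⟨r₂, s₂, d₂, β, hβ, eβ⟩ := h₂ b c hbc
  refine ⟨-(r₁ * r₂), s₂ - r₂ * s₁ * g₂, by linear_combination d₂ - r₂ * g₂ * d₁,
    transvection hbc.symm (-r₂) * (α * β * transvection hba.symm (-g₁)) *
      transvection hba (-r₁) * transvection hbc (-(s₁ * g₂)), ?_, ?_⟩
  · exact mul_mem (mul_mem (mul_mem (transvection_mem _ _) (mul_mem (mul_mem hα hβ)
      (transvection_mem _ _))) (transvection_mem _ _)) (transvection_mem _ _)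
  change (transvection hbc.symm (-r₂) : Matrix ι ι A) * ((α : Matrix ι ι A) * (β : Matrix ι ι A) *
    (transvection hba.symm (-g₁) : Matrix ι ι A)) * (transvection hba (-r₁) : Matrix ι ι A) *
    (transvection hbc (-(s₁ * g₂)) : Matrix ι ι A) = _
  rw [eα, eβ]
  refine funext fun i => ?_
  simp only [mul_apply_row]
  have ta := transvection_apply_left hba.symm (-g₁)
  have ta' := fun i => transvection_apply_of_ne (k := i) hba.symm (-g₁)
  have tb := transvection_apply_left hba (-r₁)
  have tb' := fun i => transvection_apply_of_ne (k := i) hba (-r₁)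
  have tc := transvection_apply_left hbc (-(s₁ * g₂))
  have tc' := fun i => transvection_apply_of_ne (k := i) hbc (-(s₁ * g₂))
  have td := transvection_apply_left hbc.symm (-r₂)
  have td' := fun i => transvection_apply_of_ne (k := i) hbc.symm (-r₂)
  have rowa : block a b f g₁ r₁ s₁ a ᵥ* block b c f g₂ r₂ s₂ =
      f • Pi.single a 1 + (g₁ * f) • Pi.single b 1 + (g₁ * g₂) • Pi.single c 1 := by
    rw [block_apply_left, add_vecMul, smul_vecMul, smul_vecMul, single_one_vecMul,
      single_one_vecMul, block_apply_left, block_apply_of_ne hba.symm hac]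
    module
  have rowb : block a b f g₁ r₁ s₁ b ᵥ* block b c f g₂ r₂ s₂ =
      r₁ • Pi.single a 1 + (s₁ * f) • Pi.single b 1 + (s₁ * g₂) • Pi.single c 1 := by
    rw [block_apply_right hba.symm, add_vecMul, smul_vecMul, smul_vecMul, single_one_vecMul,
      single_one_vecMul, block_apply_left, block_apply_of_ne hba.symm hac]
    module
  have rowc : block a b f g₁ r₁ s₁ c ᵥ* block b c f g₂ r₂ s₂ =
      r₂ • Pi.single b 1 + s₂ • Pi.single c 1 := by
    rw [block_apply_of_ne hac.symm hbc.symm, single_one_vecMul, block_apply_right hbc]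
  have hd : s₁ * f = 1 + g₁ * r₁ := by linear_combination d₁
  by_cases ha : i = a
  · subst ha
    simp only [block_apply_left _ c, td' _ hac, ta, tb' _ hba.symm, tc' _ hba.symm, ta' _ hba,
      ta' _ hac.symm, tb, tb' _ hbc.symm, tc, tc' _ hbc.symm, mul_apply_row, rowa,
      add_vecMul, smul_vecMul, single_one_vecMul, smul_add]
    module
  by_cases hc : i = c
  · subst hc
    simp only [block_apply_right hac, td, ta, tb' _ hba.symm, tc' _ hba.symm, ta' _ hba,
      ta' _ hac.symm, tb, tb' _ hbc.symm, tc, tc' _ hbc.symm, mul_apply_row, rowb, rowc,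
      add_vecMul, smul_vecMul, single_one_vecMul, smul_add, hd]
    module
  by_cases hb : i = b
  · subst hb
    simp only [block_apply_of_ne hba hbc, td' _ hbc, ta, tb' _ hba.symm, tc' _ hba.symm,
      ta' _ hba, ta' _ hac.symm, tb, tb' _ hbc.symm, tc, tc' _ hbc.symm, mul_apply_row, rowb,
      add_vecMul, smul_vecMul, single_one_vecMul, smul_add, hd]
    module
  · simp only [block_apply_of_ne ha hc, block_apply_of_ne ha hb, block_apply_of_ne hb hc,
      td' _ hc, ta' _ ha, tb' _ hb, tc' _ hb, mul_apply_row, single_one_vecMul]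

lemma neg_right (hι : ∀ i j : ι, ∃ p, p ≠ i ∧ p ≠ j) (h : IsElementaryPair ι f g) :
    IsElementaryPair ι f (-g) := by
  rw [neg_eq_neg_one_mul]
  exact mul_right hι (of_isUnit_right isUnit_one.neg f) h

lemma symm (hι : ∀ i j : ι, ∃ p, p ≠ i ∧ p ≠ j) (h : IsElementaryPair ι f g) :
    IsElementaryPair ι g f := by
  have h1 := (((h.add_left 1).add_right (-1)).add_left 1).neg_right hι
  convert! h1 using 1 <;> ring

lemma of_isUnit_left (hι : ∀ i j : ι, ∃ p, p ≠ i ∧ p ≠ j) (hf : IsUnit f) (g : A) :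
    IsElementaryPair ι f g :=
  (of_isUnit_right hf g).symm hι

lemma mul_left (hι : ∀ i j : ι, ∃ p, p ≠ i ∧ p ≠ j) {f₁ f₂ : A}
    (h₁ : IsElementaryPair ι f₁ g) (h₂ : IsElementaryPair ι f₂ g) :
    IsElementaryPair ι (f₁ * f₂) g :=
  ((h₁.symm hι).mul_right hι (h₂.symm hι)).symm hι

lemma of_add_right {t : A} (h : IsElementaryPair ι f (g + t * f)) : IsElementaryPair ι f g := by
  simpa using h.add_right (-t)

lemma of_add_left {t : A} (h : IsElementaryPair ι (f + t * g) g) : IsElementaryPair ι f g := by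
  simpa using h.add_left (-t)

end IsElementaryPair

end Blocks

section Reduction

variable {ι A : Type} [Fintype ι] [DecidableEq ι] [CommRing A]

lemma coe_mul_apply (σ τ : SpecialLinearGroup ι A) (i : ι) :
    ((σ * τ : SpecialLinearGroup ι A) : Matrix ι ι A) i =
      (σ : Matrix ι ι A) i ᵥ* (τ : Matrix ι ι A) := rfl

lemma vecMul_coe_mul (σ τ : SpecialLinearGroup ι A) (u : ι → A) :
    u ᵥ* ((σ * τ : SpecialLinearGroup ι A) : Matrix ι ι A) =
      u ᵥ* (σ : Matrix ι ι A) ᵥ* (τ : Matrix ι ι A) :=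
  (vecMul_vecMul _ _ _).symm

lemma vecMul_transvection {i j : ι} (h : i ≠ j) (t : A) (u : ι → A) :
    u ᵥ* (transvection h t : Matrix ι ι A) = u + u i • Pi.single j t := by
  rw [SpecialLinearGroup.transvection_coe, vecMul_add, vecMul_one]
  congr 1
  ext k
  simp [vecMul, dotProduct, Matrix.single_apply, Pi.single_apply, ite_and, eq_comm]

lemma exists_vecMul_eq_add_smul (b : ι) (v : ι → A) (hv : v b = 0) :
    ∃ E ∈ elementarySL ι A, ∀ u : ι → A, u ᵥ* (E : Matrix ι ι A) = u + u b • v := by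
  have key : ∀ s : Finset ι, b ∉ s → ∃ E ∈ elementarySL ι A, ∀ u : ι → A,
      u ᵥ* (E : Matrix ι ι A) = u + u b • ∑ j ∈ s, Pi.single j (v j) := by
    intro s
    induction s using Finset.induction_on with
    | empty => exact fun _ => ⟨1, one_mem _, fun u => by simp⟩
    | insert j s hj ih =>
      intro hb
      rw [Finset.mem_insert, not_or] at hb
      obtain ⟨E, hE, h⟩ := ih hb.2
      refine ⟨transvection hb.1 (v j) * E, mul_mem (transvection_mem _ _) hE, fun u => ?_⟩
      refine (vecMul_coe_mul _ _ _).trans ?_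
      rw [vecMul_transvection, h,
        Finset.sum_insert hj, smul_add]
      simp [hb.1, add_assoc]
  obtain ⟨E, hE, h⟩ := key (Finset.univ.erase b) (Finset.notMem_erase _ _)
  refine ⟨E, hE, fun u => ?_⟩
  have hsum : ∑ j ∈ Finset.univ.erase b, Pi.single j (v j) = v := by
    rw [Finset.sum_erase _ (by rw [hv, Pi.single_zero]), Finset.univ_sum_single]
  rw [h, hsum]

lemma apply_eq_add_smul {b : ι} {v : ι → A} {E : SpecialLinearGroup ι A}
    (h : ∀ u : ι → A, u ᵥ* (E : Matrix ι ι A) = u + u b • v) (i : ι) :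
    (E : Matrix ι ι A) i = Pi.single i 1 + (Pi.single i 1 : ι → A) b • v := by
  rw [← h, single_one_vecMul]

/-- An element of `SL` whose rows agree with the identity matrix outside the row `b`
is elementary. -/
lemma mem_elementarySL_of_row {b : ι} {σ : SpecialLinearGroup ι A}
    (hσ : ∀ i ≠ b, (σ : Matrix ι ι A) i = Pi.single i 1) : σ ∈ elementarySL ι A := by
  have hupd : (σ : Matrix ι ι A) = (1 : Matrix ι ι A).updateRow b (σ b) := by
    refine funext fun i => ?_
    by_cases hi : i = b
    · subst hi
      rw [updateRow_self]
    · rw [updateRow_ne hi, hσ i hi]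
      ext j
      simp [Matrix.one_apply, Pi.single_apply, eq_comm]
  have hdet : (σ : Matrix ι ι A) b b = 1 := by
    have h := σ.det_coe
    rwa [hupd, ← cramer_transpose_apply, transpose_one, cramer_one] at h
  obtain ⟨E, hE, h⟩ := exists_vecMul_eq_add_smul b ((σ : Matrix ι ι A) b - Pi.single b 1)
    (by simp [hdet])
  convert! hE using 1
  refine Subtype.ext (funext fun i => ?_)
  rw [apply_eq_add_smul h]
  by_cases hi : i = b
  · subst hi
    simp
  · rw [hσ i hi, Pi.single_eq_of_ne' hi, zero_smul, add_zero]

lemma mem_elementarySL_of_isElementaryPair {a b : ι} (hab : a ≠ b) {f g : A}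
    (hfg : IsElementaryPair ι f g) {σ : SpecialLinearGroup ι A}
    (hσ : ∀ i, i ≠ a → i ≠ b → (σ : Matrix ι ι A) i = Pi.single i 1)
    (ha : (σ : Matrix ι ι A) a = f • Pi.single a 1 + g • Pi.single b 1) :
    σ ∈ elementarySL ι A := by
  obtain ⟨r, s, -, τ, hτ, e⟩ := hfg a b hab
  have hrow : ∀ i, i ≠ b → (σ : Matrix ι ι A) i = (τ : Matrix ι ι A) i := by
    intro i hi
    rw [e]
    by_cases hia : i = a
    · subst hia
      rw [ha, block_apply_left]
    · rw [hσ i hia hi, block_apply_of_ne hia hi]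
  have hmem : σ * τ⁻¹ ∈ elementarySL ι A := by
    refine mem_elementarySL_of_row (b := b) fun i hi => ?_
    refine (coe_mul_apply _ _ _).trans ?_
    rw [hrow i hi, ← coe_mul_apply, mul_inv_cancel]
    ext j
    simp [Matrix.one_apply, Pi.single_apply, eq_comm]
  simpa using mul_mem hmem hτ

/-- The row `w` is obtained from `u` by an elementary matrix whose rows outside `W` agree with the
identity matrix. -/
def ColumnReach (W : Finset ι) (u w : ι → A) : Prop :=
  ∃ E ∈ elementarySL ι A, u ᵥ* (E : Matrix ι ι A) = w ∧
    ∀ j ∉ W, (E : Matrix ι ι A) j = Pi.single j 1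

namespace ColumnReach

variable {W : Finset ι} {u v w : ι → A}

lemma refl (W : Finset ι) (u : ι → A) : ColumnReach W u u :=
  ⟨1, one_mem _, by simp, fun j _ => by
    ext; simp [Matrix.one_apply, Pi.single_apply, eq_comm]⟩

lemma trans (h₁ : ColumnReach W u v) (h₂ : ColumnReach W v w) : ColumnReach W u w := by
  obtain ⟨E, hE, rfl, hE'⟩ := h₁
  obtain ⟨F, hF, rfl, hF'⟩ := h₂
  refine ⟨E * F, mul_mem hE hF, vecMul_coe_mul _ _ _,
    fun j hj => ?_⟩
  refine (coe_mul_apply _ _ _).trans ?_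
  rw [hE' j hj, single_one_vecMul, hF' j hj]

lemma add_smul {b : ι} (hb : b ∈ W) (hv : v b = 0) : ColumnReach W u (u + u b • v) := by
  obtain ⟨E, hE, h⟩ := exists_vecMul_eq_add_smul b v hv
  refine ⟨E, hE, h u, fun j hj => ?_⟩
  rw [apply_eq_add_smul h, Pi.single_eq_of_ne (by rintro rfl; exact hj hb), zero_smul, add_zero]

lemma of_apply_eq_one {r i : ι} (hr : r ∈ W) (hi : i ∈ W) (hu : u r = 1) :
    ColumnReach W u (Pi.single i 1) := by
  have h1 : ColumnReach W u (Pi.single r 1) := by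
    convert! add_smul (u := u) (v := Pi.single r 1 - u) hr (by simp [hu]) using 1
    rw [hu, one_smul, add_sub_cancel]
  by_cases hri : r = i
  · exact hri ▸ h1
  refine h1.trans ((add_smul (v := Pi.single i 1) hr (Pi.single_eq_of_ne hri _)).trans ?_)
  have h2 := add_smul (W := W) (u := Pi.single r 1 + Pi.single i 1)
    (v := -(Pi.single r 1 : ι → A)) hi (by simp [Pi.single_eq_of_ne' hri])
  simpa [Pi.single_eq_of_ne' hri] using h2

lemma of_isCoprime {p q r i : ι} (hp : p ∈ W) (hq : q ∈ W) (hr : r ∈ W) (hi : i ∈ W)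
    (hpr : p ≠ r) (hqr : q ≠ r) (hu : IsCoprime (u p) (u q)) :
    ColumnReach W u (Pi.single i 1) := by
  obtain ⟨x, y, hxy⟩ := hu
  refine (add_smul (v := Pi.single r ((1 - u r) * x)) hp (Pi.single_eq_of_ne hpr _)).trans
    ((add_smul (v := Pi.single r ((1 - u r) * y)) hq (Pi.single_eq_of_ne hqr _)).trans
      (of_apply_eq_one hr hi ?_))
  simp [Pi.single_eq_of_ne hqr]
  linear_combination (1 - u r) * hxy

end ColumnReach

/-- Prime avoidance over finitely many maximal ideals. -/
lemma exists_forall_add_mul_mem {F : Set (Ideal A)} (hF : F.Finite)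
    (hmax : ∀ M ∈ F, M.IsMaximal) (g h : A) :
    ∃ t, ∀ M ∈ F, g + h * t ∈ M → g ∈ M ∧ h ∈ M := by
  classical
  have := hF.to_subtype
  have hco : Pairwise (Function.onFun IsCoprime fun M : F => (M : Ideal A)) := fun M N hMN =>
    Ideal.isCoprime_iff_sup_eq.2
      ((hmax _ M.2).coprime_of_ne (hmax _ N.2) fun h => hMN (Subtype.ext h))
  obtain ⟨t, ht⟩ := Ideal.exists_forall_sub_mem_ideal hco
    fun M => if g ∈ (M : Ideal A) then 1 else 0
  refine ⟨t, fun M hM hmem => ?_⟩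
  have htM := ht ⟨M, hM⟩
  dsimp only at htM
  split_ifs at htM with hg
  · refine ⟨hg, ?_⟩
    have h1 : h * t ∈ M := (Ideal.add_mem_iff_right M hg).1 hmem
    convert! M.sub_mem h1 (M.mul_mem_left h htM) using 1
    ring
  · rw [sub_zero] at htM
    exact absurd ((Ideal.add_mem_iff_left M (M.mul_mem_left h htM)).1 hmem) hg

lemma ColumnReach.exists_forall_mem {W : Finset ι} {F : Set (Ideal A)} (hF : F.Finite)
    (hmax : ∀ M ∈ F, M.IsMaximal) {q : ι} (u : ι → A) (s : Finset ι) (hsW : s ⊆ W) (hqs : q ∉ s) :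
    ∃ w, ColumnReach W u w ∧ (∀ j ≠ q, w j = u j) ∧
      ∀ M ∈ F, w q ∈ M → u q ∈ M ∧ ∀ j ∈ s, u j ∈ M := by
  induction s using Finset.induction_on with
  | empty => exact ⟨u, ColumnReach.refl W u, fun _ _ => rfl, fun M _ h => ⟨h, by simp⟩⟩
  | insert r s _ ih =>
    obtain ⟨hrW, hsW⟩ := Finset.insert_subset_iff.1 hsW
    rw [Finset.mem_insert, not_or] at hqs
    obtain ⟨w, hw, hne, hmem⟩ := ih hsW hqs.2
    obtain ⟨t, ht⟩ := exists_forall_add_mul_mem hF hmax (w q) (w r)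
    refine ⟨_, hw.trans (ColumnReach.add_smul (v := Pi.single q t) hrW
      (Pi.single_eq_of_ne' hqs.1 _)), fun j hj => ?_, fun M hM h => ?_⟩
    · simp [hj, hne j hj]
    · obtain ⟨h1, h2⟩ := ht M hM (by simpa using h)
      refine ⟨(hmem M hM h1).1, fun j hj => ?_⟩
      rcases Finset.mem_insert.1 hj with rfl | hj
      · rwa [← hne j (Ne.symm hqs.1)]
      · exact (hmem M hM h1).2 j hj

/-- Stable range argument: a unimodular row with at least three entries, one of which lies in
finitely many maximal ideals, can be completed by elementary operations. -/
lemma ColumnReach.of_unimodular {W : Finset ι} (hW : 3 ≤ W.card) {u v : ι → A}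
    (hsupp : ∀ j ∉ W, u j = 0) (huv : u ⬝ᵥ v = 1) {p : ι} (hp : p ∈ W)
    (hfin : {M : Ideal A | M.IsMaximal ∧ u p ∈ M}.Finite) {i : ι} (hi : i ∈ W) :
    ColumnReach W u (Pi.single i 1) := by
  obtain ⟨q, hq⟩ : (W.erase p).Nonempty := by
    rw [← Finset.card_pos, Finset.card_erase_of_mem hp]
    omega
  obtain ⟨r, hr⟩ : ((W.erase p).erase q).Nonempty := by
    rw [← Finset.card_pos, Finset.card_erase_of_mem hq, Finset.card_erase_of_mem hp]
    omega
  simp only [Finset.mem_erase] at hq hr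
  obtain ⟨w, hw, hne, hmem⟩ := ColumnReach.exists_forall_mem hfin (fun M hM => hM.1) (q := q) u
    (W.erase q) (Finset.erase_subset _ _) (Finset.notMem_erase _ _)
  refine hw.trans (ColumnReach.of_isCoprime hp hq.2 hr.2.2 hi hr.2.1.symm hr.1.symm ?_)
  rw [← Ideal.isCoprime_span_singleton_iff, Ideal.isCoprime_iff_sup_eq, ← Ideal.span_union]
  by_contra hne'
  obtain ⟨M, hM, hle⟩ := Ideal.exists_le_maximal _ hne'
  have hpM : u p ∈ M := by
    rw [← hne p hq.1.symm]
    exact hle (Ideal.subset_span (by simp))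
  obtain ⟨h1, h2⟩ := hmem M ⟨hM, hpM⟩ (hle (Ideal.subset_span (by simp)))
  refine hM.ne_top ((Ideal.eq_top_iff_one M).2 (huv ▸ Ideal.sum_mem _ fun j _ => ?_))
  refine M.mul_mem_right _ ?_
  by_cases hjW : j ∈ W
  · by_cases hjq : j = q
    · exact hjq ▸ h1
    · exact h2 j (Finset.mem_erase.2 ⟨hjq, hjW⟩)
  · rw [hsupp j hjW]
    exact M.zero_mem

lemma exists_dotProduct_eq_one (σ : SpecialLinearGroup ι A) (i : ι) :
    ∃ v : ι → A, (σ : Matrix ι ι A) i ⬝ᵥ v = 1 := by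
  refine ⟨fun j => (σ⁻¹ : SpecialLinearGroup ι A) j i, ?_⟩
  have h : ((σ * σ⁻¹ : SpecialLinearGroup ι A) : Matrix ι ι A) i i = 1 := by simp
  exact h

/-- If the rows of `σ` outside `W` agree with the identity, then the row `i ∈ W` can be made
supported in `W` by elementary row operations. -/
lemma exists_mul_row_supported {W : Finset ι} {σ : SpecialLinearGroup ι A}
    (hσ : ∀ j ∉ W, (σ : Matrix ι ι A) j = Pi.single j 1) {i : ι} (hi : i ∈ W) :
    ∃ E ∈ elementarySL ι A,
      (∀ j ≠ i, ((E * σ : SpecialLinearGroup ι A) : Matrix ι ι A) j = (σ : Matrix ι ι A) j) ∧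
      ∀ j ∉ W, ((E * σ : SpecialLinearGroup ι A) : Matrix ι ι A) i j = 0 := by
  obtain ⟨E, hE, h⟩ := exists_vecMul_eq_add_smul i
    (fun j => if j ∈ W then 0 else -(σ : Matrix ι ι A) i j) (if_pos hi)
  set v : ι → A := fun j => if j ∈ W then 0 else -(σ : Matrix ι ι A) i j with hv
  have hvσ : v ᵥ* (σ : Matrix ι ι A) = v := by
    rw [vecMul_eq_sum]
    calc ∑ j, v j • (σ : Matrix ι ι A) j = ∑ j, Pi.single j (v j) := by
          refine Finset.sum_congr rfl fun j _ => ?_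
          by_cases hj : j ∈ W
          · simp [hv, hj]
          · rw [hσ j hj, ← Pi.single_smul, smul_eq_mul, mul_one]
      _ = v := Finset.univ_sum_single v
  have hrow : ∀ j, ((E * σ : SpecialLinearGroup ι A) : Matrix ι ι A) j =
      (σ : Matrix ι ι A) j + (Pi.single j 1 : ι → A) i • v := by
    intro j
    refine (coe_mul_apply _ _ _).trans ?_
    rw [apply_eq_add_smul h, add_vecMul, smul_vecMul,
      hvσ, single_one_vecMul]
  refine ⟨E, hE, fun j hj => ?_, fun j hj => ?_⟩
  · rw [hrow, Pi.single_eq_of_ne' hj, zero_smul, add_zero]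
  · rw [hrow]
    simp [hv, hj]

/-- `SL = E` for a ring in which unimodular pairs are elementary and every unimodular row has a
nonzero entry contained in only finitely many maximal ideals. -/
theorem mem_elementarySL_of_pairs [Nontrivial ι]
    (hfin : ∀ u v : ι → A, u ⬝ᵥ v = 1 →
      ∃ p, u p ≠ 0 ∧ {M : Ideal A | M.IsMaximal ∧ u p ∈ M}.Finite)
    (hpair : ∀ f g : A, IsCoprime f g → IsElementaryPair ι f g) (σ : SpecialLinearGroup ι A) :
    σ ∈ elementarySL ι A := by
  have key : ∀ (k : ℕ) (W : Finset ι), W.card = k + 2 → ∀ σ : SpecialLinearGroup ι A,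
      (∀ j ∉ W, (σ : Matrix ι ι A) j = Pi.single j 1) → σ ∈ elementarySL ι A := by
    intro k
    induction k with
    | zero =>
      intro W hW σ hσ
      obtain ⟨a, b, hab, rfl⟩ := Finset.card_eq_two.1 hW
      obtain ⟨E, hE, hne, hsupp⟩ := exists_mul_row_supported hσ (Finset.mem_insert_self a {b})
      obtain ⟨v, hv⟩ := exists_dotProduct_eq_one (E * σ) a
      refine (Subgroup.mul_mem_cancel_left _ hE).1 ?_
      set τ := E * σ
      have hrow : (τ : Matrix ι ι A) a = τ a a • Pi.single a 1 + τ a b • Pi.single b 1 := by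
        ext j
        by_cases hja : j = a
        · subst hja
          simp [Pi.single_eq_of_ne hab]
        by_cases hjb : j = b
        · subst hjb
          simp [Pi.single_eq_of_ne' hab]
        · simp [hja, hjb, hsupp j]
      refine mem_elementarySL_of_isElementaryPair hab (hpair (τ a a) (τ a b) ⟨v a, v b, ?_⟩)
        (fun i hia hib => ?_) hrow
      · rw [hrow] at hv
        simpa [add_dotProduct, mul_comm] using hv
      · rw [hne i hia, hσ i (by simp [hia, hib])]
    | succ k ih =>
      intro W hW σ hσ
      obtain ⟨i, hi⟩ : W.Nonempty := Finset.card_pos.1 (by omega)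
      obtain ⟨E, hE, hne, hsupp⟩ := exists_mul_row_supported hσ hi
      obtain ⟨v, hv⟩ := exists_dotProduct_eq_one (E * σ) i
      obtain ⟨p, hp0, hp⟩ := hfin _ v hv
      have hpW : p ∈ W := by
        by_contra h
        exact hp0 (hsupp p h)
      obtain ⟨F, hF, hFi, hFW⟩ := ColumnReach.of_unimodular (by omega) hsupp hv hpW hp hi
      have hmem : E * σ * F ∈ elementarySL ι A := by
        refine ih (W.erase i) (by rw [Finset.card_erase_of_mem hi]; omega) _ fun j hj => ?_
        refine (coe_mul_apply _ _ _).trans ?_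
        by_cases hji : j = i
        · subst hji
          exact hFi
        · have hjW : j ∉ W := fun h => hj (Finset.mem_erase.2 ⟨hji, h⟩)
          rw [hne j hji, hσ j hjW, single_one_vecMul, hFW j hjW]
      exact (Subgroup.mul_mem_cancel_left _ hE).1 ((Subgroup.mul_mem_cancel_right _ hF).1 hmem)
  have hcard : 1 < (Finset.univ : Finset ι).card := by
    rw [Finset.card_univ]
    exact Fintype.one_lt_card
  exact key ((Finset.univ : Finset ι).card - 2) Finset.univ (by omega) σ (by simp)

end Reduction

section Semilocal

variable {V : Type*} [CommRing V]

theorem exists_pow_sub_mul_mem {M : Ideal V[X]} (hM : M.IsMaximal) {f : V[X]} (hf : f ∈ M)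
    {c : V} (hc : Ideal.Quotient.mk (M.comap C) c =
      (f.map (Ideal.Quotient.mk (M.comap C))).leadingCoeff)
    (hc₀ : c ∉ M.comap C) {b : V} (hb : b ∉ M.comap C) :
    ∃ (k : ℕ) (v : V), c ^ k - b * v ∈ M.comap C := by
  set p : Ideal V := M.comap C with hp
  have hpp : p.IsPrime := Ideal.comap_isPrime C M
  let φ : V ⧸ p →+* V[X] ⧸ M := Ideal.quotientMap M C le_rfl
  have hφ : Function.Injective φ := Ideal.quotientMap_injective
  let l : V ⧸ p := (f.map (Ideal.Quotient.mk p)).leadingCoeff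
  have hl : l ≠ 0 := by
    rw [show l = Ideal.Quotient.mk p c from hc.symm]
    exact fun h => hc₀ (Ideal.Quotient.eq_zero_iff_mem.1 h)
  let : Field (V[X] ⧸ M) := Ideal.Quotient.field M
  have : IsLocalization ((Submonoid.powers l).map φ) (V[X] ⧸ M) := by
    refine IsLocalization.self ?_
    rintro _ ⟨_, ⟨k, rfl⟩, rfl⟩
    refine IsUnit.mk0 _ ?_
    rw [map_pow]
    exact pow_ne_zero _ ((map_ne_zero_iff φ hφ).2 hl)
  let ψ : Localization.Away l →+* V[X] ⧸ M :=
    IsLocalization.map (V[X] ⧸ M) φ (Submonoid.powers l).le_comap_map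
  have hψ : ψ.IsIntegral := Polynomial.isIntegral_isLocalization_polynomial_quotient M f hf
  have hψi : Function.Injective ψ := IsLocalization.map_injective_of_injective _ _ _ hφ
  let := ψ.toAlgebra
  have : Algebra.IsIntegral (Localization.Away l) (V[X] ⧸ M) := ⟨hψ⟩
  have hS : IsField (Localization.Away l) :=
    isField_of_isIntegral_of_isField hψi (Field.toIsField (V[X] ⧸ M))
  have hinj : Function.Injective (algebraMap (V ⧸ p) (Localization.Away l)) :=
    IsLocalization.injective _ (powers_le_nonZeroDivisors_of_noZeroDivisors hl)
  have hb' : algebraMap (V ⧸ p) (Localization.Away l) (Ideal.Quotient.mk p b) ≠ 0 := by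
    rw [map_ne_zero_iff _ hinj]
    exact fun h => hb (Ideal.Quotient.eq_zero_iff_mem.1 h)
  obtain ⟨s, hs⟩ := hS.mul_inv_cancel hb'
  obtain ⟨⟨v, ⟨_, k, rfl⟩⟩, hv⟩ := IsLocalization.surj (Submonoid.powers l) s
  obtain ⟨v, rfl⟩ := Ideal.Quotient.mk_surjective v
  refine ⟨k, v, Ideal.Quotient.eq_zero_iff_mem.1 ?_⟩
  rw [map_sub, map_pow, map_mul, hc, sub_eq_zero]
  apply hinj
  rw [map_mul]
  simp only at hv
  rw [← hv, ← mul_assoc, hs, one_mul]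

theorem comap_C_eq_of_natDegree_eq {M N : Ideal V[X]} (hM : M.IsMaximal) (hN : N.IsMaximal)
    {f : V[X]} (hf : f ∈ M) (hMN : M.comap C ≤ N.comap C)
    (hf₀ : f.map (Ideal.Quotient.mk (N.comap C)) ≠ 0)
    (hd : (f.map (Ideal.Quotient.mk (M.comap C))).natDegree =
      (f.map (Ideal.Quotient.mk (N.comap C))).natDegree) :
    M.comap C = N.comap C := by
  have hNp : (N.comap C : Ideal V).IsPrime := Ideal.comap_isPrime C N
  refine le_antisymm hMN fun b hb => ?_
  by_contra hbM
  have hcN : f.coeff (f.map (Ideal.Quotient.mk (M.comap C))).natDegree ∉ N.comap C := by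
    rw [hd, ← Ideal.Quotient.eq_zero_iff_mem, ← coeff_map]
    exact leadingCoeff_ne_zero.2 hf₀
  obtain ⟨k, v, h⟩ := exists_pow_sub_mul_mem hM hf (coeff_map _ _).symm (fun h => hcN (hMN h)) hbM
  refine hcN (hNp.mem_of_pow_mem k ?_)
  have := Ideal.add_mem _ (hMN h) (Ideal.mul_mem_right v _ hb)
  rwa [sub_add_cancel] at this

theorem finite_setOf_isMaximal_comap_C_eq (p : Ideal V) [p.IsPrime] {f : V[X]}
    (hf : ∃ i, f.coeff i ∉ p) :
    {M : Ideal V[X] | M.IsMaximal ∧ f ∈ M ∧ M.comap C = p}.Finite := by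
  let g := f.map (algebraMap V p.ResidueField)
  have hg : g ≠ 0 := by
    obtain ⟨i, hi⟩ := hf
    intro h
    apply hi
    rw [← Ideal.algebraMap_residueField_eq_zero, ← coeff_map]
    change g.coeff i = 0
    rw [h, coeff_zero]
  refine ((Ideal.finite_minimalPrimes_of_isNoetherianRing _ (Ideal.span {g})).image
    (Ideal.comap (mapRingHom (algebraMap V p.ResidueField)))).subset ?_
  rintro M ⟨hM, hfM, rfl⟩
  let : Field (V[X] ⧸ M) := Ideal.Quotient.field M
  let ψ : (M.comap C : Ideal V).ResidueField →+* V[X] ⧸ M :=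
    Ideal.ResidueField.lift _ ((Ideal.Quotient.mk M).comp C)
      (fun a ha => Ideal.Quotient.eq_zero_iff_mem.2 ha)
      (fun a ha => IsUnit.mk0 _ fun h =>
        ha (Ideal.mem_comap.2 (Ideal.Quotient.eq_zero_iff_mem.1 h)))
  let χ := eval₂RingHom ψ (Ideal.Quotient.mk M X)
  have hχ : χ.comp (mapRingHom (algebraMap V _)) = Ideal.Quotient.mk M := by
    refine Polynomial.ringHom_ext (fun a => ?_) ?_
    · simp only [χ, RingHom.comp_apply, coe_mapRingHom, map_C, coe_eval₂RingHom, eval₂_C]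
      exact Ideal.ResidueField.lift_algebraMap _ _ _ _ a
    · simp [χ]
  have hker : (RingHom.ker χ).comap (mapRingHom (algebraMap V _)) = M := by
    rw [RingHom.comap_ker, hχ, Ideal.mk_ker]
  have hgM : g ∈ RingHom.ker χ := by
    rw [← hker] at hfM
    exact hfM
  have hprime : (RingHom.ker χ).IsPrime := RingHom.ker_isPrime χ
  refine ⟨RingHom.ker χ, ⟨⟨hprime, (Ideal.span_singleton_le_iff_mem _).2 hgM⟩, ?_⟩, hker⟩
  rintro Q ⟨hQ, hgQ⟩ hle
  have hQ₀ : Q ≠ ⊥ := by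
    rintro rfl
    exact hg (by simpa using hgQ)
  exact ((hQ.isMaximal hQ₀).eq_of_le hprime.ne_top hle).ge

/-- Over a ring whose ideals form a chain, a polynomial with a unit coefficient lies in only
finitely many maximal ideals. -/
theorem finite_setOf_isMaximal_mem (hV : ∀ a b : V, a ∣ b ∨ b ∣ a) {f : V[X]}
    (hf : ∃ i, IsUnit (f.coeff i)) : {M : Ideal V[X] | M.IsMaximal ∧ f ∈ M}.Finite := by
  have htot : ∀ I J : Ideal V, I ≤ J ∨ J ≤ I := by
    intro I J
    by_contra! h
    obtain ⟨⟨a, haI, haJ⟩, b, hbJ, hbI⟩ := And.imp SetLike.not_le_iff_exists.1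
      SetLike.not_le_iff_exists.1 h
    rcases hV a b with hab | hba
    · exact hbI (I.mem_of_dvd hab haI)
    · exact haJ (J.mem_of_dvd hba hbJ)
  have hcoeff : ∀ p : Ideal V, p.IsPrime → ∃ i, f.coeff i ∉ p := fun p hp =>
    hf.imp fun i hi hip => hp.ne_top (Ideal.eq_top_of_isUnit_mem _ hip hi)
  have hne : ∀ p : Ideal V, p.IsPrime → f.map (Ideal.Quotient.mk p) ≠ 0 := by
    intro p hp h
    obtain ⟨i, hi⟩ := hcoeff p hp
    exact hi (by rw [← Ideal.Quotient.eq_zero_iff_mem, ← coeff_map, h, coeff_zero])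
  have hS : ((fun M : Ideal V[X] => (M.comap C : Ideal V)) ''
      {M | M.IsMaximal ∧ f ∈ M}).Finite := by
    refine Set.Finite.of_finite_image (f := fun p => (f.map (Ideal.Quotient.mk p)).natDegree)
      ((Set.finite_Iic f.natDegree).subset ?_) ?_
    · rintro _ ⟨p, -, rfl⟩
      exact natDegree_map_le
    · rintro _ ⟨M, ⟨hM, hfM⟩, rfl⟩ _ ⟨N, ⟨hN, hfN⟩, rfl⟩ hd
      rcases htot (M.comap C) (N.comap C) with h | h
      · exact comap_C_eq_of_natDegree_eq hM hN hfM h (hne _ (Ideal.comap_isPrime C N)) hd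
      · exact (comap_C_eq_of_natDegree_eq hN hM hfN h (hne _ (Ideal.comap_isPrime C M))
          hd.symm).symm
  refine hS.of_finite_fibers _ ?_
  rintro _ ⟨M, ⟨hM, -⟩, rfl⟩
  have hp : (M.comap C : Ideal V).IsPrime := Ideal.comap_isPrime C M
  refine (finite_setOf_isMaximal_comap_C_eq _ (hcoeff _ hp)).subset ?_
  rintro N ⟨⟨hN, hfN⟩, hNM⟩
  exact ⟨hN, hfN, hNM⟩

theorem exists_isUnit_coeff_of_dotProduct_eq_one [IsLocalRing V] {ι : Type*} [Fintype ι]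
    {u v : ι → V[X]} (h : u ⬝ᵥ v = 1) : ∃ p i, IsUnit ((u p).coeff i) := by
  by_contra! hu
  have hmem : u ⬝ᵥ v ∈ Ideal.map C (IsLocalRing.maximalIdeal V) :=
    Ideal.sum_mem _ fun p _ => Ideal.mul_mem_right _ _ <|
      Ideal.mem_map_C_iff.2 fun i => (IsLocalRing.mem_maximalIdeal _).2 (hu p i)
  rw [h] at hmem
  have := Ideal.mem_map_C_iff.1 hmem 0
  rw [coeff_one_zero] at this
  exact (IsLocalRing.mem_maximalIdeal _).1 this isUnit_one

end Semilocal

section Local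

variable {ι V : Type} [Fintype ι] [DecidableEq ι] [CommRing V]

lemma exists_mem_forall_dvd (hV : ∀ a b : V, a ∣ b ∨ b ∣ a) (c : ℕ → V) {s : Finset ℕ}
    (hs : s.Nonempty) : ∃ i ∈ s, ∀ j ∈ s, c i ∣ c j := by
  induction hs using Finset.Nonempty.cons_induction with
  | singleton a => exact ⟨a, by simp, by simp⟩
  | cons a s ha hs ih =>
    obtain ⟨i, hi, h⟩ := ih
    rcases hV (c i) (c a) with hd | hd
    · exact ⟨i, Finset.mem_cons_of_mem hi, fun j hj => by
        rcases Finset.mem_cons.1 hj with rfl | hj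
        exacts [hd, h j hj]⟩
    · exact ⟨a, Finset.mem_cons_self _ _, fun j hj => by
        rcases Finset.mem_cons.1 hj with rfl | hj
        exacts [dvd_rfl, hd.trans (h j hj)]⟩

/-- A nonzero polynomial over a ring with totally ordered divisibility is a scalar times
a polynomial with a coefficient equal to `1`. -/
lemma exists_eq_C_mul (hV : ∀ a b : V, a ∣ b ∨ b ∣ a) {g : V[X]} (hg : g ≠ 0) :
    ∃ (d : V) (h : V[X]) (k : ℕ), g = C d * h ∧ h.coeff k = 1 ∧ h.natDegree ≤ g.natDegree := by
  obtain ⟨i, hi, hdvd⟩ := exists_mem_forall_dvd hV g.coeff (nonempty_support_iff.2 hg)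
  have hdvd' : ∀ j, g.coeff i ∣ g.coeff j := fun j => by
    by_cases hj : j ∈ g.support
    · exact hdvd j hj
    · rw [notMem_support_iff.1 hj]
      exact dvd_zero _
  choose q hq using hdvd'
  have hcoeff : ∀ j, (∑ j ∈ g.support, monomial j (if j = i then 1 else q j)).coeff j =
      if j ∈ g.support then if j = i then 1 else q j else 0 := by
    intro j
    simp [coeff_monomial]
  refine ⟨g.coeff i, ∑ j ∈ g.support, monomial j (if j = i then 1 else q j), i, ?_, ?_, ?_⟩
  · ext j
    rw [coeff_C_mul, hcoeff]
    split_ifs with h1 h2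
    · rw [h2, mul_one]
    · exact hq j
    · rw [notMem_support_iff.1 h1, mul_zero]
  · rw [hcoeff, if_pos hi, if_pos rfl]
  · exact natDegree_sum_le_of_forall_le _ _ fun j hj =>
      (natDegree_monomial_le _).trans (le_natDegree_of_mem_supp j hj)

lemma eq_divX_mul_X {p : V[X]} (h : p.coeff 0 = 0) : p = divX p * X := by
  conv_lhs => rw [← divX_mul_X_add p, h, C_0, add_zero]

lemma natDegree_divX_le {p : V[X]} {D : ℕ} (h : p.natDegree ≤ D + 1) : (divX p).natDegree ≤ D := by
  rw [natDegree_divX_eq_natDegree_tsub_one]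
  omega

lemma isElementaryPair_of_isUnit_coeff_zero (hι : ∀ i j : ι, ∃ p, p ≠ i ∧ p ≠ j) {D : ℕ}
    (ih : ∀ f g : V[X], f.natDegree ≤ D → g.natDegree ≤ D → IsCoprime f g →
      IsElementaryPair ι f g)
    {f g : V[X]} (hf : f.natDegree ≤ D + 1) (hg : g.natDegree ≤ D)
    (hg0 : IsUnit (g.coeff 0)) (hfg : IsCoprime f g) : IsElementaryPair ι f g := by
  obtain ⟨v, hv⟩ := hg0.exists_left_inv
  set p := f + -C (f.coeff 0 * v) * g with hp
  have hp0 : p.coeff 0 = 0 := by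
    rw [hp, coeff_add, ← C_neg, coeff_C_mul]
    linear_combination -f.coeff 0 * hv
  have hpD : p.natDegree ≤ D + 1 := by
    refine natDegree_add_le_of_degree_le hf ?_
    rw [← C_neg]
    exact (natDegree_C_mul_le _ _).trans (by omega)
  have hpg : IsCoprime p g := by
    rw [hp]
    exact (IsCoprime.add_mul_right_left_iff).2 hfg
  refine IsElementaryPair.of_add_left (t := -C (f.coeff 0 * v)) ?_
  rw [← hp, eq_divX_mul_X hp0]
  rw [eq_divX_mul_X hp0] at hpg
  refine IsElementaryPair.mul_left hι (ih _ _ (natDegree_divX_le hpD) hg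
    hpg.of_mul_left_left) ?_
  rw [← divX_mul_X_add g, add_comm]
  exact (IsElementaryPair.of_isUnit_right (hg0.map C) X).add_right _

variable [IsLocalRing V]

lemma isUnit_coeff_zero_or_of_isCoprime {f g : V[X]} (h : IsCoprime f g) :
    IsUnit (f.coeff 0) ∨ IsUnit (g.coeff 0) := by
  obtain ⟨u, v, huv⟩ := h
  have h0 := congrArg (fun p => p.coeff 0) huv
  simp only [coeff_add, mul_coeff_zero, coeff_one_zero] at h0
  rcases IsLocalRing.isUnit_or_isUnit_of_add_one h0 with h | h
  · exact Or.inl (isUnit_of_mul_isUnit_right h)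
  · exact Or.inr (isUnit_of_mul_isUnit_right h)

lemma isElementaryPair_C_right (hι : ∀ i j : ι, ∃ p, p ≠ i ∧ p ≠ j)
    (hV : ∀ a b : V, a ∣ b ∨ b ∣ a) {f : V[X]} {d : V} (h : IsCoprime f (C d)) :
    IsElementaryPair ι f (C d) := by
  by_cases hd : IsUnit d
  · exact IsElementaryPair.of_isUnit_right (hd.map C) f
  have hf0 : IsUnit (f.coeff 0) := (isUnit_coeff_zero_or_of_isCoprime h).resolve_right
    (by rwa [coeff_C_zero])
  by_cases htail : f - C (f.coeff 0) = 0
  · rw [sub_eq_zero.1 htail]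
    exact IsElementaryPair.of_isUnit_left hι (hf0.map C) _
  obtain ⟨b, g, k, hbg, hgk, -⟩ := exists_eq_C_mul hV htail
  have hbk : (f - C (f.coeff 0)).coeff k = b := by rw [hbg, coeff_C_mul, hgk, mul_one]
  have hk : k ≠ 0 := by
    rintro rfl
    rw [coeff_sub, coeff_C_zero, sub_self] at hbk
    rw [← hbk, C_0, zero_mul] at hbg
    exact htail hbg
  rw [coeff_sub, coeff_C_of_ne_zero hk, sub_zero] at hbk
  obtain ⟨n, hn⟩ : ∃ n, d ∣ b ^ n := by
    obtain ⟨u, v, huv⟩ := h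
    have hunit : IsUnit (f.map (Ideal.Quotient.mk (Ideal.span {d}))) := by
      refine IsUnit.of_mul_eq_one (u.map (Ideal.Quotient.mk (Ideal.span {d}))) ?_
      have h1 := congrArg (Polynomial.map (Ideal.Quotient.mk (Ideal.span {d}))) huv
      have h2 : Ideal.Quotient.mk (Ideal.span {d}) d = 0 :=
        Ideal.Quotient.eq_zero_iff_mem.2 (Ideal.mem_span_singleton_self d)
      simpa [h2, mul_comm] using h1
    obtain ⟨n, hn⟩ := (isUnit_iff_coeff_isUnit_isNilpotent.1 hunit).2 k hk
    refine ⟨n, ?_⟩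
    rwa [coeff_map, hbk, ← map_pow, Ideal.Quotient.eq_zero_iff_mem,
      Ideal.mem_span_singleton] at hn
  have hdiv : ∀ e, e ∣ b → IsElementaryPair ι f (C e) := by
    rintro e ⟨c, hc⟩
    have h1 := (IsElementaryPair.of_isUnit_left hι (hf0.map C) (C e)).add_left (C c * g)
    convert! h1 using 1
    rw [← sub_eq_iff_eq_add', hbg, hc, C_mul]
    ring
  have hpow : ∀ k, IsElementaryPair ι f (C (b ^ k)) := by
    intro k
    induction k with
    | zero => exact IsElementaryPair.of_isUnit_right (by simp) f
    | succ k ih =>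
      rw [pow_succ, C_mul]
      exact ih.mul_right hι (hdiv b dvd_rfl)
  by_contra hQ
  have hall : ∀ k, b ^ k ∣ d := by
    intro k
    induction k with
    | zero => simp
    | succ k ih =>
      obtain ⟨e, rfl⟩ := ih
      rcases hV b e with he | he
      · rw [pow_succ]
        exact mul_dvd_mul_left _ he
      · rw [C_mul] at hQ
        exact absurd ((hpow k).mul_right hι (hdiv e he)) hQ
  have hb : ¬ IsUnit b := fun hb => hd (isUnit_of_dvd_unit hn (hb.pow n))
  obtain ⟨z, hz⟩ := (hall (n + 1)).trans hn
  have hz' : b ^ n * (1 - b * z) = 0 := by linear_combination hz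
  have hbz : IsUnit (1 - b * z) :=
    (IsLocalRing.isUnit_or_isUnit_one_sub_self (b * z)).resolve_left
      fun h => hb (isUnit_of_mul_isUnit_left h)
  have hbn : b ^ n = 0 := (hbz.mul_left_eq_zero).1 hz'
  have hd0 : d = 0 := zero_dvd_iff.1 (hbn ▸ hall n)
  rw [hd0, C_0, isCoprime_zero_right] at h
  exact hQ (IsElementaryPair.of_isUnit_left hι h _)

lemma isElementaryPair_of_isUnit_coeff (hι : ∀ i j : ι, ∃ p, p ≠ i ∧ p ≠ j) {D : ℕ}
    (ih : ∀ f g : V[X], f.natDegree ≤ D → g.natDegree ≤ D → IsCoprime f g →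
      IsElementaryPair ι f g)
    {f : V[X]} (hf : f.natDegree ≤ D + 1) (k : ℕ) : ∀ g : V[X], g.natDegree ≤ D →
      IsUnit (g.coeff k) → IsCoprime f g → IsElementaryPair ι f g := by
  induction k with
  | zero => exact fun g hg hg0 hfg => isElementaryPair_of_isUnit_coeff_zero hι ih hf hg hg0 hfg
  | succ k ihk =>
    intro g hg hgk hfg
    by_cases hg0 : IsUnit (g.coeff 0)
    · exact isElementaryPair_of_isUnit_coeff_zero hι ih hf hg hg0 hfg
    have hf0 := (isUnit_coeff_zero_or_of_isCoprime hfg).resolve_right hg0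
    obtain ⟨v, hv⟩ := hf0.exists_left_inv
    set p := g + -C (g.coeff 0 * v) * f with hp
    have hp0 : p.coeff 0 = 0 := by
      rw [hp, coeff_add, ← C_neg, coeff_C_mul]
      linear_combination -g.coeff 0 * hv
    have hpD : p.natDegree ≤ D + 1 := by
      refine natDegree_add_le_of_degree_le (by omega) ?_
      rw [← C_neg]
      exact (natDegree_C_mul_le _ _).trans hf
    have hpf : IsCoprime f p := by
      rw [hp]
      exact (IsCoprime.add_mul_right_right_iff).2 hfg
    have hpk : IsUnit ((divX p).coeff k) := by
      rw [coeff_divX, hp, coeff_add, ← C_neg, coeff_C_mul]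
      by_contra hnon
      have h1 := IsLocalRing.nonunits_add (a := g.coeff (k + 1) + -(g.coeff 0 * v) *
        f.coeff (k + 1)) (b := g.coeff 0 * (v * f.coeff (k + 1))) hnon
        (fun h => hg0 (isUnit_of_mul_isUnit_left h))
      exact h1 (by convert! hgk using 1; ring)
    refine IsElementaryPair.of_add_right (t := -C (g.coeff 0 * v)) ?_
    rw [← hp, eq_divX_mul_X hp0]
    rw [eq_divX_mul_X hp0] at hpf
    refine IsElementaryPair.mul_right hι (ihk _ (natDegree_divX_le hpD) hpk
      hpf.of_mul_right_left) ?_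
    rw [← divX_mul_X_add f, add_comm]
    exact (IsElementaryPair.of_isUnit_left hι (hf0.map C) X).add_left _

theorem isElementaryPair_of_isCoprime (hι : ∀ i j : ι, ∃ p, p ≠ i ∧ p ≠ j)
    (hV : ∀ a b : V, a ∣ b ∨ b ∣ a) {f g : V[X]} (h : IsCoprime f g) :
    IsElementaryPair ι f g := by
  have key : ∀ (D : ℕ) (f g : V[X]), f.natDegree ≤ D → g.natDegree ≤ D → IsCoprime f g →
      IsElementaryPair ι f g := by
    intro D
    induction D with
    | zero =>
      intro f g _ hg hfg
      rw [eq_C_of_natDegree_le_zero hg] at hfg ⊢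
      exact isElementaryPair_C_right hι hV hfg
    | succ D ih =>
      have core : ∀ f g : V[X], f.natDegree ≤ D + 1 → g.natDegree ≤ D → IsCoprime f g →
          IsElementaryPair ι f g := by
        intro f g hf hg hfg
        by_cases hg0 : g = 0
        · rw [hg0, isCoprime_zero_right] at hfg
          exact IsElementaryPair.of_isUnit_left hι hfg g
        obtain ⟨d, q, k, rfl, hqk, hq⟩ := exists_eq_C_mul hV hg0
        exact (isElementaryPair_C_right hι hV hfg.of_mul_right_left).mul_right hι
          (isElementaryPair_of_isUnit_coeff hι ih hf k q (hq.trans hg) (hqk ▸ isUnit_one)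
            hfg.of_mul_right_right)
      have lead : ∀ f g : V[X], f.natDegree ≤ D + 1 → g.natDegree ≤ D + 1 → IsCoprime f g →
          f.coeff (D + 1) ∣ g.coeff (D + 1) → IsElementaryPair ι f g := by
        rintro f g hf hg hfg ⟨c, hc⟩
        refine IsElementaryPair.of_add_right (t := -C c) (core f _ hf ?_
          ((IsCoprime.add_mul_right_right_iff).2 hfg))
        rw [natDegree_le_iff_coeff_eq_zero]
        intro N hN
        rw [← C_neg, coeff_add, coeff_C_mul]
        rcases (Nat.succ_le_of_lt hN).eq_or_lt with rfl | hN
        · rw [Nat.succ_eq_add_one, hc]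
          ring
        · rw [coeff_eq_zero_of_natDegree_lt (hg.trans_lt hN),
            coeff_eq_zero_of_natDegree_lt (hf.trans_lt hN), mul_zero, add_zero]
      intro f g hf hg hfg
      rcases hV (f.coeff (D + 1)) (g.coeff (D + 1)) with hd | hd
      · exact lead f g hf hg hfg hd
      · exact (lead g f hg hf hfg.symm hd).symm hι
  exact key (max f.natDegree g.natDegree) f g (le_max_left _ _) (le_max_right _ _) h

end Local

section Main

theorem mem_elementarySL_polynomial_of_isLocalRing {ι V : Type} [Fintype ι] [DecidableEq ι]
    [Nontrivial ι] [CommRing V] [IsLocalRing V] (hι : ∀ i j : ι, ∃ p, p ≠ i ∧ p ≠ j)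
    (hV : ∀ a b : V, a ∣ b ∨ b ∣ a) (σ : SpecialLinearGroup ι V[X]) :
    σ ∈ elementarySL ι V[X] := by
  refine mem_elementarySL_of_pairs (fun u v huv => ?_)
    (fun f g h => isElementaryPair_of_isCoprime hι hV h) σ
  obtain ⟨p, i, hi⟩ := exists_isUnit_coeff_of_dotProduct_eq_one huv
  refine ⟨p, fun hp => ?_, finite_setOf_isMaximal_mem hV ⟨i, hi⟩⟩
  rw [hp, coeff_zero] at hi
  exact not_isUnit_zero hi

/-- Over an arithmetical ring, every `σ ∈ SL_ι(R[X])` is `σ(0)` times an elementary matrix. -/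
theorem inv_map_constantPart_mul_mem {ι R : Type} [Fintype ι] [DecidableEq ι] [Nontrivial ι]
    [CommRing R] (hι : ∀ i j : ι, ∃ p, p ≠ i ∧ p ≠ j)
    (hR : ∀ (m : Ideal R) [m.IsMaximal] (a b : Localization.AtPrime m), a ∣ b ∨ b ∣ a)
    (σ : SpecialLinearGroup ι R[X]) :
    (SpecialLinearGroup.map (constantPart R) σ)⁻¹ * σ ∈ elementarySL ι R[X] := by
  refine mem_elementarySL_of_forall_isMaximal hι ?_
    fun m _ => mem_elementarySL_polynomial_of_isLocalRing hι (hR m) _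
  rw [map_mul, map_inv, map_comp_apply, constantPart_comp_constantPart, inv_mul_cancel]

end Main

end ElementaryPolynomial

theorem stmt_15 {R : Type} [CommRing R]
    (hR : ∀ (m : Ideal R) (hm : m.IsMaximal),
      ∀ a b : @Localization.AtPrime R _ m hm.isPrime, a ∣ b ∨ b ∣ a)
    (n : ℕ) (hn : 3 ≤ n) (σ : Matrix (Fin n) (Fin n) R[X]) (hσ : σ.det = 1) :
    ∃ E ∈ Elem (Fin n) R[X], σ = σ.map (fun p => C (p.eval 0)) * E := by
  have hι : ∀ i j : Fin n, ∃ p, p ≠ i ∧ p ≠ j := fun i j => by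
    obtain ⟨p, hp⟩ := Finset.exists_mem_notMem_of_card_lt_card
      (s := {i, j}) (t := (Finset.univ : Finset (Fin n)))
      (Finset.card_le_two.trans_lt (by rw [Finset.card_univ, Fintype.card_fin]; exact hn))
    exact ⟨p, by simpa using hp⟩
  have : Nontrivial (Fin n) := Fin.nontrivial_iff_two_le.2 (by omega)
  let τ : SpecialLinearGroup (Fin n) R[X] := ⟨σ, hσ⟩
  have hτ := ElementaryPolynomial.inv_map_constantPart_mul_mem hι (fun m hm => hR m hm) τ
  refine ⟨_, ElementaryPolynomial.coe_mem_Elem hτ, ?_⟩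
  exact congrArg Subtype.val
    (mul_inv_cancel_left (SpecialLinearGroup.map (ElementaryPolynomial.constantPart R) τ) τ).symm
end

section
/- Let R be an arithmetical ring and n ≥ 3. Then every matrix σ(x) ∈ SLₙ(R[x]) is congruent to σ(0) modulo Eₙ(R[x]): there exists E ∈ Eₙ(R[x]) with σ(x)·E = σ(0). -/
open Matrix Polynomial

theorem map_transvection {ι R S : Type} [DecidableEq ι] [CommRing R] [CommRing S]
    (f : R →+* S) (i j : ι) (a : R) :
    (transvection i j a).map f = transvection i j (f a) := by
  ext k l
  simp [transvection, single_apply, one_apply, apply_ite f]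

section Basics

variable {ι κ R S : Type} [Fintype ι] [DecidableEq ι] [Fintype κ] [DecidableEq κ]
  [CommRing R] [CommRing S]

theorem transvection_mem_Elem {i j : ι} (h : i ≠ j) (a : R) :
    transvection i j a ∈ Elem ι R :=
  Submonoid.subset_closure ⟨i, j, a, h, rfl⟩

theorem det_of_mem_Elem {E : Matrix ι ι R} (hE : E ∈ Elem ι R) : E.det = 1 := by
  induction hE using Submonoid.closure_induction with
  | mem x hx =>
    obtain ⟨i, j, a, h, rfl⟩ := hx
    exact det_transvection_of_ne i j h a
  | one => simp
  | mul x y _ _ hx hy => simp [hx, hy]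

theorem transpose_mem_Elem {E : Matrix ι ι R} (hE : E ∈ Elem ι R) : Eᵀ ∈ Elem ι R := by
  induction hE using Submonoid.closure_induction with
  | mem x hx =>
    obtain ⟨i, j, a, h, rfl⟩ := hx
    have : (transvection i j a)ᵀ = transvection j i a := by
      simp [transvection, transpose_add]
    rw [this]
    exact transvection_mem_Elem h.symm a
  | one => simp
  | mul x y _ _ hx hy => rw [transpose_mul]; exact mul_mem hy hx

theorem adjugate_mem_Elem {E : Matrix ι ι R} (hE : E ∈ Elem ι R) :
    E.adjugate ∈ Elem ι R := by
  induction hE using Submonoid.closure_induction with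
  | mem x hx =>
    obtain ⟨i, j, a, h, rfl⟩ := hx
    have h1 : transvection i j a * transvection i j (-a) = 1 := by
      rw [transvection_mul_transvection_same _ _ h]; simp
    have h2 : (transvection i j a).adjugate * transvection i j a = 1 := by
      rw [adjugate_mul, det_transvection_of_ne i j h, one_smul]
    rw [left_inv_eq_right_inv h2 h1]
    exact transvection_mem_Elem h _
  | one => simp
  | mul x y _ _ hx hy => rw [adjugate_mul_distrib]; exact mul_mem hy hx

theorem mem_Elem_of_mul_mem_left {E M : Matrix ι ι R} (hE : E ∈ Elem ι R)
    (h : E * M ∈ Elem ι R) : M ∈ Elem ι R := by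
  have := mul_mem (adjugate_mem_Elem hE) h
  rwa [← mul_assoc, adjugate_mul, det_of_mem_Elem hE, one_smul, one_mul] at this

theorem mem_Elem_of_mul_mem_right {E M : Matrix ι ι R} (hE : E ∈ Elem ι R)
    (h : M * E ∈ Elem ι R) : M ∈ Elem ι R := by
  have := mul_mem h (adjugate_mem_Elem hE)
  rwa [mul_assoc, mul_adjugate, det_of_mem_Elem hE, one_smul, mul_one] at this

theorem map_mem_Elem (f : R →+* S) {E : Matrix ι ι R} (hE : E ∈ Elem ι R) :
    E.map f ∈ Elem ι S := by
  induction hE using Submonoid.closure_induction with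
  | mem x hx =>
    obtain ⟨i, j, a, h, rfl⟩ := hx
    rw [map_transvection]
    exact transvection_mem_Elem h _
  | one => rw [Matrix.map_one _ f.map_zero f.map_one]; exact one_mem _
  | mul x y _ _ hx hy => rw [Matrix.map_mul]; exact mul_mem hx hy

theorem submatrix_mem_Elem (e : κ ≃ ι) {E : Matrix ι ι R} (hE : E ∈ Elem ι R) :
    E.submatrix e e ∈ Elem κ R := by
  induction hE using Submonoid.closure_induction with
  | mem x hx =>
    obtain ⟨i, j, a, h, rfl⟩ := hx
    have : (transvection i j a).submatrix e e = transvection (e.symm i) (e.symm j) a := by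
      ext k l
      simp [transvection, single_apply, one_apply, Equiv.symm_apply_eq]
    rw [this]
    exact transvection_mem_Elem (by simpa using h) a
  | one => simp
  | mul x y _ _ hx hy => rw [← submatrix_mul_equiv x y e e e]; exact mul_mem hx hy

theorem fromBlocks_mem_Elem {E : Matrix ι ι R} (hE : E ∈ Elem ι R) :
    fromBlocks E 0 0 (1 : Matrix κ κ R) ∈ Elem (ι ⊕ κ) R := by
  induction hE using Submonoid.closure_induction with
  | mem x hx =>
    obtain ⟨i, j, a, h, rfl⟩ := hx
    have := TransvectionStruct.toMatrix_sumInl κ ⟨i, j, h, a⟩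
    simp only [TransvectionStruct.sumInl, TransvectionStruct.toMatrix_mk] at this
    rw [← this]
    exact transvection_mem_Elem (by simpa using h) a
  | one => rw [fromBlocks_one]; exact one_mem _
  | mul x y _ _ hx hy =>
    have := mul_mem hx hy
    simpa [fromBlocks_multiply] using this

theorem one_add_vecMulVec_single_mem_Elem {c : ι → R} {j : ι} (hc : c j = 0) :
    1 + vecMulVec c (Pi.single j 1) ∈ Elem ι R := by
  suffices h : ∀ s : Finset ι, j ∉ s →
      1 + vecMulVec (∑ l ∈ s, Pi.single l (c l)) (Pi.single j 1) ∈ Elem ι R by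
    have h1 := h (Finset.univ.erase j) (by simp)
    have h2 : (∑ l ∈ Finset.univ.erase j, Pi.single l (c l)) = c := by
      rw [← Finset.univ_sum_single c, Finset.univ_sum_single c]
      conv_rhs => rw [← Finset.univ_sum_single c, ← Finset.add_sum_erase _ _ (Finset.mem_univ j)]
      simp [hc]
    rwa [h2] at h1
  intro s
  induction s using Finset.induction_on with
  | empty => intro _; simp
  | insert a s ha ih =>
    intro hj
    rw [Finset.mem_insert, not_or] at hj
    have h3 := mul_mem (ih hj.2) (transvection_mem_Elem (R := R) (Ne.symm hj.1) (c a))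
    rw [Finset.sum_insert ha, add_comm (Pi.single a (c a) : ι → R), add_vecMulVec]
    convert h3 using 1
    have h4 : (Matrix.single a j (c a) : Matrix ι ι R)
        = vecMulVec (Pi.single a (c a)) (Pi.single j 1) := by
      ext k l
      simp [Matrix.single_apply, vecMulVec_apply, Pi.single_apply, ← ite_and, eq_comm, and_comm]
    rw [transvection, h4, add_mul, one_mul, mul_add, mul_one, vecMulVec_mul_vecMulVec]
    simp [hj.1, add_assoc, add_comm]

end Basics

section RowEquiv

variable {ι R : Type} [Fintype ι] [DecidableEq ι] [CommRing R]

theorem RowEquivE.refl (v : ι → R) : RowEquivE v v :=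
  ⟨1, one_mem _, vecMul_one v⟩

theorem RowEquivE.trans {u v w : ι → R} (h₁ : RowEquivE u v) (h₂ : RowEquivE v w) :
    RowEquivE u w := by
  obtain ⟨E, hE, rfl⟩ := h₁
  obtain ⟨F, hF, rfl⟩ := h₂
  exact ⟨E * F, mul_mem hE hF, (vecMul_vecMul _ _ _).symm⟩

theorem RowEquivE.symm {u v : ι → R} (h : RowEquivE u v) : RowEquivE v u := by
  obtain ⟨E, hE, rfl⟩ := h
  refine ⟨E.adjugate, adjugate_mem_Elem hE, ?_⟩
  rw [vecMul_vecMul, mul_adjugate, det_of_mem_Elem hE, one_smul, vecMul_one]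

theorem RowEquivE.exists_dotProduct_eq_one {u v : ι → R} (h : RowEquivE u v)
    (hu : ∃ w, u ⬝ᵥ w = 1) : ∃ w, v ⬝ᵥ w = 1 := by
  obtain ⟨E, hE, rfl⟩ := h.symm
  obtain ⟨w, hw⟩ := hu
  exact ⟨E *ᵥ w, by rw [dotProduct_mulVec, hw]⟩

theorem RowEquivE.add_single_dotProduct (v : ι → R) {c : ι → R} {j : ι} (hc : c j = 0) :
    RowEquivE v (v + Pi.single j (v ⬝ᵥ c)) := by
  refine ⟨_, one_add_vecMulVec_single_mem_Elem hc, ?_⟩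
  rw [vecMul_add, vecMul_one, vecMul_vecMulVec]
  congr 1
  ext k
  simp [Pi.single_apply]

theorem RowEquivE.add_single_mul (v : ι → R) {i j : ι} (h : i ≠ j) (r : R) :
    RowEquivE v (v + Pi.single j (v i * r)) := by
  have := RowEquivE.add_single_dotProduct v (c := Pi.single i r) (j := j) (by simp [h.symm])
  simpa using this

theorem RowEquivE.single_one (i j : ι) :
    RowEquivE (Pi.single i (1 : R)) (Pi.single j 1) := by
  rcases eq_or_ne i j with rfl | h
  · exact .refl _
  refine (RowEquivE.add_single_mul _ h 1).trans ((RowEquivE.add_single_mul _ h.symm (-1)).trans ?_)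
  have e : (Pi.single i 1 + Pi.single j ((Pi.single i 1 : ι → R) i * 1) : ι → R)
      + Pi.single i ((Pi.single i 1 + Pi.single j ((Pi.single i 1 : ι → R) i * 1) : ι → R) j * -1)
      = Pi.single j 1 := by
    simp only [Pi.add_apply, Pi.single_eq_same, Pi.single_eq_of_ne h.symm, mul_one, zero_add,
      mul_neg, Pi.single_neg]
    abel
  rw [e]
  exact .refl _

theorem RowEquivE.single_of_isUnit {v : ι → R} {i j : ι} (h : i ≠ j) (hv : IsUnit (v i)) :
    RowEquivE v (Pi.single j 1) := by
  obtain ⟨s, hs⟩ := hv.exists_right_inv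
  have h1 : RowEquivE v (v + Pi.single j (1 - v j)) := by
    have := RowEquivE.add_single_mul v h (s * (1 - v j))
    rwa [← mul_assoc, hs, one_mul] at this
  refine h1.trans ?_
  set u := v + Pi.single j (1 - v j) with hu
  have huj : u j = 1 := by simp [hu]
  suffices ∀ s : Finset ι, j ∉ s → RowEquivE u (u - ∑ l ∈ s, Pi.single l (u l)) by
    convert this (Finset.univ.erase j) (by simp)
    rw [eq_sub_iff_add_eq, ← huj,
      Finset.add_sum_erase _ (fun l => (Pi.single l (u l) : ι → R)) (Finset.mem_univ j),
      Finset.univ_sum_single]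
  intro s
  induction s using Finset.induction_on with
  | empty => intro _; simpa using .refl _
  | insert a s ha ih =>
    intro hj
    rw [Finset.mem_insert, not_or] at hj
    refine (ih hj.2).trans ?_
    have := RowEquivE.add_single_mul (u - ∑ l ∈ s, Pi.single l (u l)) hj.1 (-u a)
    convert this using 1
    have : (∑ l ∈ s, (Pi.single l (u l) : ι → R)) j = 0 := by
      rw [Finset.sum_apply]
      refine Finset.sum_eq_zero fun l hl => ?_
      rw [Pi.single_apply, if_neg]
      rintro rfl
      exact hj.2 hl
    rw [Finset.sum_insert ha, Pi.sub_apply, this, huj]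
    simp only [sub_zero, one_mul, Pi.single_neg]
    abel

/-- A row can be moved along `p j • e i - p i • e j` as soon as it takes the value one on `p`. -/
theorem RowEquivE.add_koszul {v p : ι → R} (hp : v ⬝ᵥ p = 1) {i j k : ι} (hij : i ≠ j)
    (hik : i ≠ k) (hjk : j ≠ k) (r : R) :
    RowEquivE v (v + Pi.single i (r * p j) + Pi.single j (-(r * p i))) := by
  let w : R → R → R → ι → R := fun a b c => v + Pi.single i a + Pi.single j b + Pi.single k c
  have wi : ∀ a b c, w a b c i = v i + a := fun a b c => by simp [w, hij, hik]
  have wj : ∀ a b c, w a b c j = v j + b := fun a b c => by simp [w, hij.symm, hjk]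
  have wk : ∀ a b c, w a b c k = v k + c := fun a b c => by simp [w, hik.symm, hjk.symm]
  have wp : ∀ a b c, w a b c ⬝ᵥ p = 1 + a * p i + b * p j + c * p k := fun a b c => by
    simp [w, add_dotProduct, hp]
  have si : ∀ (a b c : R) {d : ι → R} (x : R), d i = 0 → w a b c ⬝ᵥ d = x →
      RowEquivE (w a b c) (w (a + x) b c) := fun a b c d x hd hx => by
    convert RowEquivE.add_single_dotProduct (w a b c) hd using 1
    simp only [w, hx, Pi.single_add]
    abel
  have sj : ∀ (a b c : R) {d : ι → R} (x : R), d j = 0 → w a b c ⬝ᵥ d = x →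
      RowEquivE (w a b c) (w a (b + x) c) := fun a b c d x hd hx => by
    convert RowEquivE.add_single_dotProduct (w a b c) hd using 1
    simp only [w, hx, Pi.single_add]
    abel
  have sk : ∀ (a b c : R) {d : ι → R} (x : R), d k = 0 → w a b c ⬝ᵥ d = x →
      RowEquivE (w a b c) (w a b (c + x)) := fun a b c d x hd hx => by
    convert RowEquivE.add_single_dotProduct (w a b c) hd using 1
    simp only [w, hx, Pi.single_add]
    abel
  have w0 : v = w 0 0 0 := by simp [w]
  have wf : v + Pi.single i (r * p j) + Pi.single j (-(r * p i)) = w (r * p j) (-(r * p i)) 0 := by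
    simp [w]
  rw [wf, w0]
  set m := v i * p i + v j * p j with hm
  have h1 := sk 0 0 0 (d := Pi.single i (p i) + Pi.single j (p j)) m
    (by simp [hik.symm, hjk.symm]) (by simp [dotProduct_add, wi, wj, hm])
  have h2 := si 0 0 (0 + m) (d := Pi.single k (r * p j)) ((v k + m) * (r * p j))
    (by simp [hik]) (by simp [wk])
  have h3 := sj (0 + (v k + m) * (r * p j)) 0 (0 + m) (d := Pi.single k (-(r * p i)))
    (-((v k + m) * (r * p i))) (by simp [hjk]) (by simp [wk])
  have h4 := sk (0 + (v k + m) * (r * p j)) (0 + -((v k + m) * (r * p i))) (0 + m)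
    (d := -(Pi.single i (p i) + Pi.single j (p j))) (-m)
    (by simp [hik.symm, hjk.symm])
    (by simp only [dotProduct_add, dotProduct_neg, dotProduct_single, wi, wj, hm]; ring)
  have h5 := si (0 + (v k + m) * (r * p j)) (0 + -((v k + m) * (r * p i))) (0 + m + -m)
    (d := Pi.single k (-(r * p j))) (-(v k * (r * p j)))
    (by simp [hik]) (by simp [wk])
  have h6 := sj (0 + (v k + m) * (r * p j) + -(v k * (r * p j)))
    (0 + -((v k + m) * (r * p i))) (0 + m + -m)
    (d := Pi.single k (r * p i)) (v k * (r * p i))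
    (by simp [hjk]) (by simp [wk])
  have e1 : w (0 + (v k + m) * (r * p j) + -(v k * (r * p j)))
      (0 + -((v k + m) * (r * p i)) + v k * (r * p i)) (0 + m + -m)
      = w (m * (r * p j)) (-(m * (r * p i))) 0 := by
    congr 1 <;> ring
  rw [e1] at h6
  have h7 := si (m * (r * p j)) (-(m * (r * p i))) 0
    (d := (r * p j) • (p - Pi.single i (p i) - Pi.single j (p j))) ((r * p j) * (1 - m))
    (by simp [hij])
    (by simp only [dotProduct_smul, dotProduct_sub, dotProduct_single, wi, wj, wp, hm, smul_eq_mul]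
        ring)
  have h8 := sj (m * (r * p j) + (r * p j) * (1 - m)) (-(m * (r * p i))) 0
    (d := (-(r * p i)) • (p - Pi.single i (p i) - Pi.single j (p j))) (-(r * p i) * (1 - m))
    (by simp [hij.symm])
    (by simp only [dotProduct_smul, dotProduct_sub, dotProduct_single, wi, wj, wp, hm, smul_eq_mul]
        ring)
  have e2 : w (m * (r * p j) + (r * p j) * (1 - m)) (-(m * (r * p i)) + -(r * p i) * (1 - m)) 0
      = w (r * p j) (-(r * p i)) 0 := by
    congr 1 <;> ring
  rw [e2] at h8
  exact h1.trans (h2.trans (h3.trans (h4.trans (h5.trans (h6.trans (h7.trans h8))))))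

/-- Scaling two entries of a unimodular row by an element which is invertible modulo a third
entry. -/
theorem RowEquivE.scale_pair {v q : ι → R} (hq : v ⬝ᵥ q = 1) {i j z : ι} (hij : i ≠ j)
    (hiz : i ≠ z) (hjz : j ≠ z) {t s k : R} (hts : t * s + v z * k = 1) :
    RowEquivE v (v + Pi.single i ((t - 1) * v i) + Pi.single j ((t - 1) * v j)) := by
  have h1 := RowEquivE.add_koszul hq hij hiz hjz (-1)
  set v1 := v + Pi.single i (-1 * q j) + Pi.single j (-(-1 * q i)) with hv1
  let p2 := q + Pi.single i (-v j - q i) + Pi.single j (v i - q j)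
  have hp2 : v1 ⬝ᵥ p2 = 1 := by
    simp only [p2, hv1, dotProduct_add, add_dotProduct, hq, dotProduct_single, single_dotProduct,
      Pi.add_apply, Pi.single_eq_same, Pi.single_eq_of_ne hij, Pi.single_eq_of_ne hij.symm]
    ring
  have h2 := RowEquivE.add_koszul hp2 hij hiz hjz (t - 1)
  set v2 := v1 + Pi.single i ((t - 1) * p2 j) + Pi.single j (-((t - 1) * p2 i)) with hv2
  let p3 := (s * t) • q + Pi.single i ((s - s * t) * q i) + Pi.single j ((s - s * t) * q j)
    + Pi.single z k
  have hp3 : v2 ⬝ᵥ p3 = 1 := by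
    have e : v2 ⬝ᵥ q = 1 - (v i * q i + v j * q j) + t * (v i * q i + v j * q j) := by
      simp only [p2, hv2, hv1, add_dotProduct, hq, single_dotProduct,
        Pi.add_apply, Pi.single_eq_same, Pi.single_eq_of_ne hij, Pi.single_eq_of_ne hij.symm]
      ring
    simp only [p3, dotProduct_add, dotProduct_smul, e, dotProduct_single, smul_eq_mul]
    simp only [hv2, hv1, p2,
      Pi.add_apply, Pi.single_eq_same, Pi.single_eq_of_ne hij, Pi.single_eq_of_ne hij.symm,
      Pi.single_eq_of_ne hiz.symm, Pi.single_eq_of_ne hjz.symm]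
    linear_combination hts
  have h3 := RowEquivE.add_koszul hp3 hij hiz hjz t
  have hz : ∀ x y : R, ∀ u : ι → R,
      (u + Pi.single i x + Pi.single j y : ι → R) z = u z := fun x y u => by
    simp [hiz.symm, hjz.symm]
  refine h1.trans (h2.trans (h3.trans ?_))
  have hvz : (v2 + Pi.single i (t * p3 j) + Pi.single j (-(t * p3 i)) : ι → R) z = v z := by
    rw [hz, hv2, hz, hv1, hz]
  set v3 := v2 + Pi.single i (t * p3 j) + Pi.single j (-(t * p3 i)) with hv3
  have h4 := RowEquivE.add_single_mul v3 hiz.symm (k * q j)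
  have h5 := RowEquivE.add_single_mul (v3 + Pi.single i (v3 z * (k * q j))) hjz.symm (-(k * q i))
  refine h4.trans ?_
  convert h5 using 1
  have hvz' : (v3 + Pi.single i (v3 z * (k * q j)) : ι → R) z = v z := by
    simp [hiz.symm, hvz]
  rw [hvz', hvz]
  have ei : p3 i = s * q i := by
    simp [p3, hij, hiz]; ring
  have ej : p3 j = s * q j := by
    simp [p3, hij.symm, hjz]; ring
  rw [hv3, ei, ej, hv2, hv1]
  have ei : p2 i = -v j := by
    simp [p2, hij]
  have ej : p2 j = v i := by
    simp [p2, hij.symm]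
  rw [ei, ej]
  ext l
  rcases eq_or_ne l i with rfl | hli
  · simp only [Pi.add_apply, Pi.single_eq_same, Pi.single_eq_of_ne hij]
    linear_combination (-q j) * hts
  rcases eq_or_ne l j with rfl | hlj
  · simp only [Pi.add_apply, Pi.single_eq_same, Pi.single_eq_of_ne hli]
    linear_combination q i * hts
  · simp only [Pi.add_apply, Pi.single_eq_of_ne hli, Pi.single_eq_of_ne hlj]
    ring

end RowEquiv

section ValuationRing

variable {ι A V : Type} [Fintype ι] [DecidableEq ι] [CommRing A] [CommRing V]

theorem RowEquivE.unscale_pair {v : ι → A} (hv : ∃ w, v ⬝ᵥ w = 1) {i j z : ι} (hij : i ≠ j)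
    (hiz : i ≠ z) (hjz : j ≠ z) {t s k a b : A} (hts : t * s + v z * k = 1)
    (ha : v i = t * a) (hb : v j = t * b) :
    RowEquivE v (v + Pi.single i (a - v i) + Pi.single j (b - v j)) := by
  obtain ⟨w, hw⟩ := hv
  set u : ι → A := v + Pi.single i (a - v i) + Pi.single j (b - v j) with hu
  have ui : u i = a := by simp [hu, hij]
  have uj : u j = b := by simp [hu, hij.symm]
  have uz : u z = v z := by simp [hu, hiz.symm, hjz.symm]
  have hq : u ⬝ᵥ (w + Pi.single i ((t - 1) * w i) + Pi.single j ((t - 1) * w j)) = 1 := by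
    simp only [dotProduct_add, dotProduct_single, ui, uj]
    simp only [hu, add_dotProduct, single_dotProduct, hw, ha, hb]
    ring
  have h := RowEquivE.scale_pair hq hij hiz hjz (t := t) (s := s) (k := k) (by rwa [uz])
  convert h.symm using 1
  rw [ui, uj]
  ext l
  rcases eq_or_ne l i with rfl | hli
  · simp only [hu, Pi.add_apply, Pi.single_eq_same, Pi.single_eq_of_ne hij]
    linear_combination ha
  rcases eq_or_ne l j with rfl | hlj
  · simp only [hu, Pi.add_apply, Pi.single_eq_same, Pi.single_eq_of_ne hli]
    linear_combination hb
  · simp [hu, hli, hlj]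

theorem exists_mul_X_add_mul_eq_one {f : V[X]} (hf : IsUnit (f.coeff 0)) :
    ∃ s k : V[X], X * s + f * k = 1 := by
  obtain ⟨u, hu⟩ := hf.exists_right_inv
  refine ⟨-(C u * f.divX), C u, ?_⟩
  have h1 : (C (f.coeff 0) : V[X]) * C u = 1 := by rw [← C_mul, hu, C_1]
  linear_combination (-C u) * (divX_mul_X_add f) + h1

theorem natDegree_divX_sub_le {p q : V[X]} {D : ℕ} (hp : p.natDegree ≤ D + 1)
    (hq : q.natDegree ≤ D + 1) (c : V) : (divX (p - C c * q)).natDegree ≤ D := by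
  rw [natDegree_divX_eq_natDegree_tsub_one]
  have := natDegree_sub_le_of_le hp ((natDegree_C_mul_le c q).trans hq)
  rw [max_self] at this
  lia

/-- If the entry `v z` has an invertible constant term, two other entries can be made divisible
by `X` and then divided by `X`. -/
theorem RowEquivE.exists_divX_pair {v : ι → V[X]} (hv : ∃ w, v ⬝ᵥ w = 1) {i j z : ι}
    (hij : i ≠ j) (hiz : i ≠ z) (hjz : j ≠ z) (hz : IsUnit ((v z).coeff 0)) :
    ∃ v', RowEquivE v v' ∧ (∀ l, l ≠ i → l ≠ j → v' l = v l) ∧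
      ∀ l, l = i ∨ l = j → ∃ c, (v l).coeff 0 = c * (v z).coeff 0 ∧
        v' l = divX (v l - C c * v z) := by
  obtain ⟨u, hu⟩ := hz.exists_left_inv
  have hX : ∀ l, v l - C ((v l).coeff 0 * u) * v z
      = X * divX (v l - C ((v l).coeff 0 * u) * v z) := fun l => by
    have := divX_mul_X_add (v l - C ((v l).coeff 0 * u) * v z)
    rw [coeff_sub, coeff_C_mul, mul_assoc, hu, mul_one, sub_self, C_0, add_zero] at this
    rw [mul_comm X, this]
  have hc : ∀ l, (v l).coeff 0 = (v l).coeff 0 * u * (v z).coeff 0 := fun l => by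
    rw [mul_assoc, hu, mul_one]
  have h1 := RowEquivE.add_single_mul v hiz.symm (-C ((v i).coeff 0 * u))
  have h2 := RowEquivE.add_single_mul (v + Pi.single i (v z * -C ((v i).coeff 0 * u)))
    hjz.symm (-C ((v j).coeff 0 * u))
  have h12 := h1.trans h2
  set w := v + Pi.single i (v z * -C ((v i).coeff 0 * u)) +
    Pi.single j ((v + Pi.single i (v z * -C ((v i).coeff 0 * u)) : ι → V[X]) z *
      -C ((v j).coeff 0 * u)) with hw
  have wi : w i = v i - C ((v i).coeff 0 * u) * v z := by
    simp [hw, hij]; ring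
  have wj : w j = v j - C ((v j).coeff 0 * u) * v z := by
    simp [hw, hij.symm, hiz.symm]; ring
  have wz : w z = v z := by simp [hw, hiz.symm, hjz.symm]
  obtain ⟨s, k, hsk⟩ := exists_mul_X_add_mul_eq_one hz
  have h3 := RowEquivE.unscale_pair (h12.exists_dotProduct_eq_one hv) hij hiz hjz
    (by rw [wz]; exact hsk) (wi.trans (hX i)) (wj.trans (hX j))
  refine ⟨_, h12.trans h3, fun l hli hlj => by simp [hw, hli, hlj], ?_⟩
  rintro l (rfl | rfl)
  · exact ⟨_, hc l, by simp [hij]⟩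
  · exact ⟨_, hc l, by simp [hij.symm]⟩

theorem exists_forall_dvd (hV : ∀ a b : V, a ∣ b ∨ b ∣ a) {α : Type} (s : Finset α) (f : α → V)
    (hs : s.Nonempty) : ∃ a ∈ s, ∀ b ∈ s, f a ∣ f b := by
  induction hs using Finset.Nonempty.cons_induction with
  | singleton a => exact ⟨a, by simp⟩
  | cons a s ha hs ih =>
    obtain ⟨b, hb, h⟩ := ih
    rcases hV (f a) (f b) with hab | hab
    · refine ⟨a, by simp, fun c hc => ?_⟩
      rcases Finset.mem_cons.1 hc with rfl | hc
      · exact dvd_rfl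
      · exact hab.trans (h c hc)
    · refine ⟨b, by simp [hb], fun c hc => ?_⟩
      rcases Finset.mem_cons.1 hc with rfl | hc
      · exact hab
      · exact h c hc

theorem exists_eq_C_mul_of_coeff {p : V[X]} {N : ℕ} (hN : p.natDegree ≤ N) {d : V} {q : ℕ → V}
    (hq : ∀ m ≤ N, p.coeff m = d * q m) :
    ∃ a : V[X], p = C d * a ∧ a.natDegree ≤ N ∧ ∀ m ≤ N, a.coeff m = q m := by
  have hc : ∀ m, (∑ l ∈ Finset.range (N + 1), monomial l (q l)).coeff m
      = if m ≤ N then q m else 0 := fun m => by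
    simp [finsetSum_coeff, coeff_monomial]
  refine ⟨∑ l ∈ Finset.range (N + 1), monomial l (q l), ?_, ?_, fun m hm => by rw [hc, if_pos hm]⟩
  · ext m
    rw [coeff_C_mul, hc]
    split_ifs with hm
    · exact hq m hm
    · rw [mul_zero, coeff_eq_zero_of_natDegree_lt (lt_of_le_of_lt hN (not_le.1 hm))]
  · exact natDegree_le_iff_coeff_eq_zero.2 fun m hm => by rw [hc, if_neg (not_le.2 hm)]

theorem RowEquivE.natDegree_le_off {v : ι → V[X]} (hι : ∀ a b : ι, ∃ c, c ≠ a ∧ c ≠ b)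
    (hv : ∃ w, v ⬝ᵥ w = 1) {z : ι} {D : ℕ} (hz : IsUnit ((v z).coeff 0))
    (hD : ∀ l, (v l).natDegree ≤ D + 1) :
    ∃ v', RowEquivE v v' ∧ v' z = v z ∧ ∀ l ≠ z, (v' l).natDegree ≤ D := by
  suffices h : ∀ s : Finset ι, z ∉ s → ∃ v', RowEquivE v v' ∧ v' z = v z ∧
      (∀ l, (v' l).natDegree ≤ D + 1) ∧ ∀ l ∈ s, (v' l).natDegree ≤ D by
    obtain ⟨v', h1, h2, -, h3⟩ := h (Finset.univ.erase z) (by simp)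
    exact ⟨v', h1, h2, fun l hl => h3 l (by simp [hl])⟩
  intro s
  induction s using Finset.induction_on with
  | empty => exact fun _ => ⟨v, .refl v, rfl, hD, by simp⟩
  | insert a s ha ih =>
    intro hzs
    rw [Finset.mem_insert, not_or] at hzs
    obtain ⟨u, h1, h2, h3, h4⟩ := ih hzs.2
    obtain ⟨j, hjz, hja⟩ := hι z a
    obtain ⟨u', h5, h6, h7⟩ := RowEquivE.exists_divX_pair (h1.exists_dotProduct_eq_one hv)
      hja.symm (Ne.symm hzs.1) hjz (by rwa [h2])
    have h8 : ∀ l, l = a ∨ l = j → (u' l).natDegree ≤ D := fun l hl => by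
      obtain ⟨c, -, hc⟩ := h7 l hl
      rw [hc]
      exact natDegree_divX_sub_le (h3 l) (h3 z) c
    refine ⟨u', h1.trans h5, (h6 z hzs.1 hjz.symm).trans h2, fun l => ?_, fun l hl => ?_⟩
    · by_cases hl : l = a ∨ l = j
      · exact (h8 l hl).trans (Nat.le_succ D)
      · rw [not_or] at hl
        rw [h6 l hl.1 hl.2]
        exact h3 l
    · by_cases hl' : l = a ∨ l = j
      · exact h8 l hl'
      · rw [not_or] at hl'
        rw [h6 l hl'.1 hl'.2]
        exact h4 l (by simpa [hl'.1] using hl)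

variable [IsLocalRing V]

theorem exists_isUnit_coeff_zero {ι : Type} [Fintype ι] {v : ι → V[X]} (hv : ∃ w, v ⬝ᵥ w = 1) :
    ∃ i, IsUnit ((v i).coeff 0) := by
  obtain ⟨w, hw⟩ := hv
  have h : ∑ i, (v i).coeff 0 * (w i).coeff 0 = 1 := by
    have := congrArg (fun p => p.coeff 0) hw
    simpa [dotProduct, finsetSum_coeff, mul_coeff_zero] using this
  obtain ⟨i, -, hi⟩ := IsLocalRing.exists_of_isUnit_sum (h ▸ isUnit_one)
  exact ⟨i, isUnit_of_mul_isUnit_left hi⟩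

theorem isUnit_sub_mul_of_not_isUnit {a b c : V} (ha : IsUnit a) (hc : ¬ IsUnit c) :
    IsUnit (a - c * b) := by
  by_contra h
  have := IsLocalRing.nonunits_add h (mul_mem_nonunits_left (b := b) hc)
  rw [sub_add_cancel] at this
  exact this ha

theorem RowEquivE.exists_single_of_isUnit_coeff (hι : ∀ a b : ι, ∃ c, c ≠ a ∧ c ≠ b) {D : ℕ}
    (ih : ∀ v : ι → V[X], (∃ w, v ⬝ᵥ w = 1) → (∀ l, (v l).natDegree ≤ D) →
      ∃ i, RowEquivE v (Pi.single i 1)) (k : ℕ) {v : ι → V[X]}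
    (hv : ∃ w, v ⬝ᵥ w = 1) {z : ι} (hz : IsUnit ((v z).coeff 0))
    (hzD : (v z).natDegree ≤ D + 1) (hD : ∀ l ≠ z, (v l).natDegree ≤ D) {i : ι} (hiz : i ≠ z)
    (hi : IsUnit ((v i).coeff k)) : ∃ i, RowEquivE v (Pi.single i 1) := by
  have hD' : ∀ l, (v l).natDegree ≤ D + 1 := fun l => by
    rcases eq_or_ne l z with rfl | hl
    · exact hzD
    · exact (hD l hl).trans (Nat.le_succ D)
  induction k generalizing v with
  | zero =>
    obtain ⟨j, hji, hjz⟩ := hι i z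
    obtain ⟨u, h1, h2, h3⟩ := RowEquivE.exists_divX_pair hv hjz.symm hiz.symm hji hi
    obtain ⟨m, hm⟩ := ih u (h1.exists_dotProduct_eq_one hv) fun l => by
      by_cases hl : l = z ∨ l = j
      · obtain ⟨c, -, hc⟩ := h3 l hl
        rw [hc]
        exact natDegree_divX_sub_le (hD' l) (hD' i) c
      · rw [not_or] at hl
        rw [h2 l hl.1 hl.2]
        exact hD l hl.1
    exact ⟨m, h1.trans hm⟩
  | succ k ihk =>
    by_cases hi0 : IsUnit ((v i).coeff 0)
    · obtain ⟨j, hji, hjz⟩ := hι i z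
      obtain ⟨u, h1, h2, h3⟩ := RowEquivE.exists_divX_pair hv hjz.symm hiz.symm hji hi0
      obtain ⟨m, hm⟩ := ih u (h1.exists_dotProduct_eq_one hv) fun l => by
        by_cases hl : l = z ∨ l = j
        · obtain ⟨c, -, hc⟩ := h3 l hl
          rw [hc]
          exact natDegree_divX_sub_le (hD' l) (hD' i) c
        · rw [not_or] at hl
          rw [h2 l hl.1 hl.2]
          exact hD l hl.1
      exact ⟨m, h1.trans hm⟩
    · obtain ⟨j, hji, hjz⟩ := hι i z
      obtain ⟨u, h1, h2, h3⟩ := RowEquivE.exists_divX_pair hv hji.symm hiz hjz hz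
      have huz := h2 z hiz.symm hjz.symm
      have huD : ∀ l ≠ z, (u l).natDegree ≤ D := fun l hlz => by
        by_cases hl : l = i ∨ l = j
        · obtain ⟨c, -, hc⟩ := h3 l hl
          rw [hc]
          exact natDegree_divX_sub_le (hD' l) (hD' z) c
        · rw [not_or] at hl
          rw [h2 l hl.1 hl.2]
          exact hD l hlz
      obtain ⟨c, hc, hui⟩ := h3 i (Or.inl rfl)
      obtain ⟨m, hm⟩ := ihk (h1.exists_dotProduct_eq_one hv) (huz ▸ hz) (huz ▸ hzD) huD
        (by
          rw [hui, coeff_divX, coeff_sub, coeff_C_mul]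
          exact isUnit_sub_mul_of_not_isUnit hi fun h => hi0 (hc ▸ h.mul hz))
        fun l => by
          rcases eq_or_ne l z with rfl | hl
          · rw [huz]; exact hzD
          · exact (huD l hl).trans (Nat.le_succ D)
      exact ⟨m, h1.trans hm⟩

/-- The elementary group acts transitively on unimodular rows of length at least three over
`V[X]`, for a local ring `V` in which divisibility is total. -/
theorem RowEquivE.exists_single (hV : ∀ a b : V, a ∣ b ∨ b ∣ a)
    (hι : ∀ a b : ι, ∃ c, c ≠ a ∧ c ≠ b) {v : ι → V[X]} (hv : ∃ w, v ⬝ᵥ w = 1) :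
    ∃ i, RowEquivE v (Pi.single i 1) := by
  classical
  obtain ⟨D, hD⟩ : ∃ D, ∀ l, (v l).natDegree ≤ D :=
    ⟨Finset.univ.sup fun l => (v l).natDegree,
      fun l => Finset.le_sup (f := fun l => (v l).natDegree) (Finset.mem_univ l)⟩
  induction D generalizing v with
  | zero =>
    obtain ⟨i, hi⟩ := exists_isUnit_coeff_zero hv
    obtain ⟨j, hj, -⟩ := hι i i
    refine ⟨j, RowEquivE.single_of_isUnit hj.symm ?_⟩
    rw [eq_C_of_natDegree_le_zero (hD i)]
    exact hi.map C
  | succ D ih =>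
    obtain ⟨z, hz⟩ := exists_isUnit_coeff_zero hv
    obtain ⟨u, h1, huz, huD⟩ := RowEquivE.natDegree_le_off hι hv hz hD
    have hu := h1.exists_dotProduct_eq_one hv
    rw [← huz] at hz
    have hzD : (u z).natDegree ≤ D + 1 := huz ▸ hD z
    suffices ∃ i, RowEquivE u (Pi.single i 1) by
      obtain ⟨i, hi⟩ := this
      exact ⟨i, h1.trans hi⟩
    obtain ⟨j₀, hj₀, -⟩ := hι z z
    obtain ⟨⟨i, k⟩, hik, hmin⟩ := exists_forall_dvd hV
      ((Finset.univ.erase z) ×ˢ Finset.range (D + 1)) (fun x => (u x.1).coeff x.2)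
      ⟨(j₀, 0), by simp [hj₀]⟩
    simp only [Finset.mem_product, Finset.mem_erase, Finset.mem_univ, and_true,
      Finset.mem_range] at hik
    set d := (u i).coeff k with hd
    have hdvd : ∀ l, l ≠ z → ∃ g : V[X], u l = C d * g := fun l hl => by
      refine (C_dvd_iff_dvd_coeff _ _).2 fun m => ?_
      rcases lt_or_ge m (D + 1) with hm | hm
      · exact hmin (l, m) (by simp [hl, hm])
      · rw [coeff_eq_zero_of_natDegree_lt (lt_of_le_of_lt (huD l hl) hm)]
        exact dvd_zero _
    choose! g hg using hdvd
    obtain ⟨w, hw⟩ := hu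
    have hcop : C d * (∑ l ∈ Finset.univ.erase z, g l * w l) + u z * w z = 1 := by
      rw [← hw, dotProduct, ← Finset.add_sum_erase _ _ (Finset.mem_univ z), add_comm,
        Finset.mul_sum]
      congr 1
      refine Finset.sum_congr rfl fun l hl => ?_
      rw [hg l (Finset.ne_of_mem_erase hl), mul_assoc]
    have hfac : ∀ l ≠ z, ∃ a : V[X], u l = C d * a ∧ a.natDegree ≤ D ∧
        ((u l).coeff k = d → a.coeff k = 1) := fun l hl => by
      obtain ⟨a, h2, h3, h4⟩ := exists_eq_C_mul_of_coeff (huD l hl) (d := d)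
        (q := fun m => if m = k ∧ (u l).coeff k = d then 1 else (g l).coeff m) fun m _ => by
          split_ifs with h
          · rw [mul_one, h.1, h.2]
          · rw [hg l hl, coeff_C_mul]
      exact ⟨a, h2, h3, fun h => by rw [h4 k (Nat.lt_succ_iff.1 hik.2), if_pos ⟨rfl, h⟩]⟩
    obtain ⟨a, ha, haD, hak⟩ := hfac i hik.1
    obtain ⟨j, hji, hjz⟩ := hι i z
    obtain ⟨b, hb, hbD, -⟩ := hfac j hjz
    have h2 := RowEquivE.unscale_pair ⟨w, hw⟩ hji.symm hik.1 hjz hcop ha hb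
    obtain ⟨m, hm⟩ := RowEquivE.exists_single_of_isUnit_coeff hι (D := D) (fun v hv hD => ih hv hD)
      k (h2.exists_dotProduct_eq_one ⟨w, hw⟩) (z := z) (i := i)
      (by simpa [hik.1.symm, hjz.symm] using hz) (by simpa [hik.1.symm, hjz.symm] using hzD)
      (fun l hl => by
        rcases eq_or_ne l i with rfl | hli
        · simpa [hji.symm] using haD
        rcases eq_or_ne l j with rfl | hlj
        · simpa [hji] using hbD
        · simpa [hli, hlj] using huD l hl) hik.1
      (by simp [hji.symm, hak rfl])
    exact ⟨m, h2.trans hm⟩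

end ValuationRing

section Mennicke

variable {A : Type} [CommRing A]

/-- Every matrix of determinant one with first row `(a, b)` is elementary after stabilization to
size three, that is, the Mennicke symbol of `(a, b)` is trivial. -/
def MennickeTrivial (a b : A) : Prop :=
  ∀ c d : A, a * d - b * c = 1 → !![a, b, 0; c, d, 0; 0, 0, 1] ∈ Elem (Fin 3) A

theorem MennickeTrivial.of_add_mul_right {a b : A} (r : A) (h : MennickeTrivial a (b + r * a)) :
    MennickeTrivial a b := fun c d hcd => by
  refine mem_Elem_of_mul_mem_right
    (transvection_mem_Elem (show (0 : Fin 3) ≠ 1 by decide) r) ?_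
  convert h c (d + r * c) (by linear_combination hcd) using 1
  ext i j
  fin_cases i <;> fin_cases j <;>
    simp [transvection, mul_add, mul_apply, Fin.sum_univ_three, single_apply] <;> ring

theorem MennickeTrivial.of_add_mul_left {a b : A} (r : A) (h : MennickeTrivial (a + r * b) b) :
    MennickeTrivial a b := fun c d hcd => by
  refine mem_Elem_of_mul_mem_right
    (transvection_mem_Elem (show (1 : Fin 3) ≠ 0 by decide) r) ?_
  convert h (c + r * d) d (by linear_combination hcd) using 1
  ext i j
  fin_cases i <;> fin_cases j <;>
    simp [transvection, mul_add, mul_apply, Fin.sum_univ_three, single_apply] <;> ring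

theorem MennickeTrivial.one_zero : MennickeTrivial (1 : A) 0 := fun c d hcd => by
  convert transvection_mem_Elem (show (1 : Fin 3) ≠ 0 by decide) c using 1
  have hd : d = 1 := by linear_combination hcd
  subst hd
  ext i j
  fin_cases i <;> fin_cases j <;> simp [transvection]

theorem MennickeTrivial.of_isUnit_left {a : A} (ha : IsUnit a) (b : A) : MennickeTrivial a b := by
  obtain ⟨s, hs⟩ := ha.exists_right_inv
  have h1 : MennickeTrivial (1 : A) (1 - a) :=
    .of_add_mul_right (-(1 - a)) (by convert MennickeTrivial.one_zero using 1; ring)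
  have h2 : MennickeTrivial a (1 - a) := .of_add_mul_left 1 (by convert h1 using 1; ring)
  exact .of_add_mul_right (s * (1 - a - b)) (by
    convert h2 using 1; linear_combination (1 - a - b) * hs)

theorem MennickeTrivial.of_isUnit_right (a : A) {b : A} (hb : IsUnit b) : MennickeTrivial a b := by
  obtain ⟨s, hs⟩ := hb.exists_right_inv
  exact .of_add_mul_left (s * (1 - a)) (by
    convert MennickeTrivial.of_isUnit_left isUnit_one b using 1; linear_combination (1 - a) * hs)

theorem MennickeTrivial.mul_right {a b₁ b₂ : A} (h₁ : MennickeTrivial a b₁)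
    (h₂ : MennickeTrivial a b₂) : MennickeTrivial a (b₁ * b₂) := fun c d hcd => by
  have hα : !![a, 0, b₁; 0, 1, 0; b₂ * c, 0, d] ∈ Elem (Fin 3) A := by
    convert submatrix_mem_Elem (Equiv.swap (1 : Fin 3) 2)
      (h₁ (b₂ * c) d (by linear_combination hcd)) using 1
    ext i j
    fin_cases i <;> fin_cases j <;> simp [Equiv.swap_apply_def]
  have hβ : !![1, 0, 0; 0, a, b₁ * c; 0, b₂, d] ∈ Elem (Fin 3) A := by
    convert transpose_mem_Elem (submatrix_mem_Elem (finRotate 3).symm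
      (h₂ (b₁ * c) d (by linear_combination hcd))) using 1
    ext i j
    fin_cases i <;> fin_cases j <;> rfl
  have hN : !![1, 0, 0; 0, d, -(b₁ * c); 0, -b₂, a] ∈ Elem (Fin 3) A := by
    refine mem_Elem_of_mul_mem_right hβ ?_
    convert one_mem (Elem (Fin 3) A) using 1
    ext i j
    fin_cases i <;> fin_cases j <;> simp [mul_apply, Fin.sum_univ_three] <;>
      first | linear_combination 0 * hcd | linear_combination hcd
  have h := mul_mem (mul_mem (mul_mem
    (transvection_mem_Elem (show (1 : Fin 3) ≠ 0 by decide) (c * d))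
    (transvection_mem_Elem (show (2 : Fin 3) ≠ 0 by decide) (-(b₂ * c)))) hN) hα
  refine mem_Elem_of_mul_mem_left
    (transvection_mem_Elem (show (0 : Fin 3) ≠ 2 by decide) b₁) ?_
  refine mem_Elem_of_mul_mem_right
    (transvection_mem_Elem (show (2 : Fin 3) ≠ 1 by decide) (-b₂)) ?_
  convert h using 1
  ext i j
  fin_cases i <;> fin_cases j <;>
    simp [transvection, add_mul, mul_add, mul_apply, Fin.sum_univ_three, single_apply] <;>
      first
        | linear_combination 0 * hcd | linear_combination (-1) * hcd | linear_combination (-c) * hcd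

theorem MennickeTrivial.swap {a b : A} (h : MennickeTrivial b a) : MennickeTrivial a b := by
  have h1 : MennickeTrivial b (a * -1) := h.mul_right (.of_isUnit_right b isUnit_one.neg)
  refine .of_add_mul_left 1 (.of_add_mul_right (-1) (.of_add_mul_left 1 ?_))
  convert h1 using 1 <;> ring

end Mennicke

section MennickeValuationRing

variable {V : Type} [CommRing V]

theorem MennickeTrivial.of_eq_C_add {f h : V[X]} {u b : V} (hu : IsUnit u)
    (hf : f = C u + C b * h) : MennickeTrivial f (C b) :=
  .of_add_mul_left (-h) (by
    convert MennickeTrivial.of_isUnit_left (hu.map C) (C b) using 1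
    rw [hf]; ring)

theorem MennickeTrivial.X_right {f : V[X]} (hf : IsUnit (f.coeff 0)) : MennickeTrivial f X :=
  .of_add_mul_left (-divX f) (by
    convert MennickeTrivial.of_isUnit_left (hf.map C) X using 1
    linear_combination -(divX_mul_X_add f))

theorem MennickeTrivial.exists_divX {f g : V[X]} (hf : IsUnit (f.coeff 0)) (h : IsCoprime f g) :
    ∃ c, g.coeff 0 = c * f.coeff 0 ∧ IsCoprime f (divX (g - C c * f)) ∧
      (MennickeTrivial f (divX (g - C c * f)) → MennickeTrivial f g) := by
  obtain ⟨u, hu⟩ := hf.exists_left_inv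
  have hX : X * divX (g - C (g.coeff 0 * u) * f) = g + -C (g.coeff 0 * u) * f := by
    have := divX_mul_X_add (g - C (g.coeff 0 * u) * f)
    rw [coeff_sub, coeff_C_mul, mul_assoc, hu, mul_one, sub_self, C_0, add_zero] at this
    rw [mul_comm X, this]
    ring
  refine ⟨g.coeff 0 * u, by rw [mul_assoc, hu, mul_one], ?_, fun hM => ?_⟩
  · refine IsCoprime.of_mul_right_right (y := X) ?_
    rw [hX]
    exact h.add_mul_right_right _
  · refine .of_add_mul_right (-C (g.coeff 0 * u)) ?_
    rw [← hX]
    exact (MennickeTrivial.X_right hf).mul_right hM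

theorem isNilpotent_coeff_of_isCoprime_C {f : V[X]} {c : V} (h : IsCoprime f (C c)) {m : ℕ}
    (hm : m ≠ 0) : ∃ k, c ∣ f.coeff m ^ k := by
  obtain ⟨s, t, hst⟩ := h
  have hu : IsUnit (f.map (Ideal.Quotient.mk (Ideal.span {c}))) := by
    refine IsUnit.of_mul_eq_one_right (s.map (Ideal.Quotient.mk (Ideal.span {c}))) ?_
    have := congrArg (Polynomial.map (Ideal.Quotient.mk (Ideal.span {c}))) hst
    simpa [Ideal.Quotient.eq_zero_iff_mem.2 (Ideal.mem_span_singleton_self c)] using this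
  obtain ⟨k, hk⟩ := (isUnit_iff_coeff_isUnit_isNilpotent.1 hu).2 m hm
  refine ⟨k, ?_⟩
  rwa [coeff_map, ← map_pow, Ideal.Quotient.eq_zero_iff_mem, Ideal.mem_span_singleton] at hk

variable [IsLocalRing V]

theorem isUnit_coeff_zero_or_of_isCoprime {f g : V[X]} (h : IsCoprime f g) :
    IsUnit (f.coeff 0) ∨ IsUnit (g.coeff 0) := by
  obtain ⟨s, t, hst⟩ := h
  have := congrArg (fun p => p.coeff 0) hst
  simp only [coeff_add, mul_coeff_zero, coeff_one_zero] at this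
  exact (IsLocalRing.isUnit_or_isUnit_of_add_one this).imp isUnit_of_mul_isUnit_right
    isUnit_of_mul_isUnit_right

theorem MennickeTrivial.C_right (hV : ∀ a b : V, a ∣ b ∨ b ∣ a) {f : V[X]} {c : V}
    (h : IsCoprime f (C c)) : MennickeTrivial f (C c) := by
  by_cases hc : IsUnit c
  · exact .of_isUnit_right f (hc.map C)
  have hf : IsUnit (f.coeff 0) :=
    (isUnit_coeff_zero_or_of_isCoprime h).resolve_right (by simpa using hc)
  obtain ⟨m, -, hm⟩ := exists_forall_dvd hV (Finset.range (f.natDegree + 1))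
    (fun m => f.coeff (m + 1)) ⟨0, by simp⟩
  set d := f.coeff (m + 1) with hd
  obtain ⟨q, hq⟩ : C d ∣ divX f := (C_dvd_iff_dvd_coeff _ _).2 fun l => by
    rw [coeff_divX]
    rcases lt_or_ge l (f.natDegree + 1) with hl | hl
    · exact hm l (by simpa using hl)
    · rw [coeff_eq_zero_of_natDegree_lt (by lia)]
      exact dvd_zero _
  have hfq : f = C (f.coeff 0) + C d * (q * X) := by
    linear_combination -(divX_mul_X_add f) + X * hq
  have hM : ∀ b, b ∣ d → MennickeTrivial f (C b) := by
    rintro b ⟨e, he⟩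
    refine .of_eq_C_add hf (h := C e * (q * X)) ?_
    rw [he, C_mul] at hfq
    linear_combination hfq
  have hpow : ∀ j, MennickeTrivial f (C (d ^ j)) := fun j => by
    induction j with
    | zero => exact .of_isUnit_right f (by simp)
    | succ j ih => rw [pow_succ, C_mul]; exact ih.mul_right (hM d dvd_rfl)
  have key : ∀ j, d ^ j ∣ c ∨ MennickeTrivial f (C c) := fun j => by
    induction j with
    | zero => simp
    | succ j ih =>
      refine ih.elim ?_ .inr
      rintro ⟨e, rfl⟩
      rcases hV d e with he | he
      · exact .inl (pow_succ d j ▸ mul_dvd_mul_left _ he)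
      · rw [C_mul]
        exact .inr ((hpow j).mul_right (hM e he))
  obtain ⟨k, hk⟩ := isNilpotent_coeff_of_isCoprime_C h (Nat.succ_ne_zero m)
  rcases key (k + 1) with hj | hj
  · have hdu : ¬ IsUnit d := fun hdu => hc (isUnit_of_dvd_unit hk (hdu.pow k))
    obtain ⟨e, he⟩ := hj.trans hk
    have h0 : d ^ k = 0 := by
      refine (isUnit_sub_mul_of_not_isUnit (b := e) isUnit_one hdu).mul_left_eq_zero.1 ?_
      linear_combination he
    have hc0 : c = 0 := by
      rw [pow_succ, h0, zero_mul] at hj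
      exact zero_dvd_iff.1 hj
    rw [hc0, C_0, isCoprime_zero_right] at h
    exact .of_isUnit_left h _
  · exact hj

theorem MennickeTrivial.of_isUnit_coeff {D : ℕ}
    (ih : ∀ f g : V[X], IsCoprime f g → f.natDegree ≤ D → g.natDegree ≤ D → MennickeTrivial f g)
    (k : ℕ) {f g : V[X]} (h : IsCoprime f g) (hf : IsUnit (f.coeff 0))
    (hfD : f.natDegree ≤ D + 1) (hgD : g.natDegree ≤ D) (hg : IsUnit (g.coeff k)) :
    MennickeTrivial f g := by
  have hgD' := hgD.trans (Nat.le_succ D)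
  by_cases hg0 : IsUnit (g.coeff 0)
  · obtain ⟨c, -, h1, h2⟩ := MennickeTrivial.exists_divX hg0 h.symm
    exact (h2 (ih _ _ h1 hgD (natDegree_divX_sub_le hfD hgD' c))).swap
  · induction k generalizing g with
    | zero => exact absurd hg hg0
    | succ k ihk =>
      obtain ⟨c, hc, h1, h2⟩ := MennickeTrivial.exists_divX hf h
      have hD := natDegree_divX_sub_le hgD' hfD c
      have hD' := hD.trans (Nat.le_succ D)
      refine h2 ?_
      by_cases hg0' : IsUnit ((divX (g - C c * f)).coeff 0)
      · obtain ⟨c, -, h3, h4⟩ := MennickeTrivial.exists_divX hg0' h1.symm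
        exact (h4 (ih _ _ h3 hD (natDegree_divX_sub_le hfD hD' c))).swap
      · refine ihk h1 hD ?_ hD' hg0'
        rw [coeff_divX, coeff_sub, coeff_C_mul]
        exact isUnit_sub_mul_of_not_isUnit hg fun h => hg0 (hc ▸ h.mul hf)

/-- All Mennicke symbols over `V[X]` are trivial for a local ring `V` in which divisibility is
total. -/
theorem MennickeTrivial.of_isCoprime (hV : ∀ a b : V, a ∣ b ∨ b ∣ a) {f g : V[X]}
    (h : IsCoprime f g) : MennickeTrivial f g := by
  obtain ⟨D, hfD, hgD⟩ : ∃ D, f.natDegree ≤ D ∧ g.natDegree ≤ D :=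
    ⟨max f.natDegree g.natDegree, le_max_left _ _, le_max_right _ _⟩
  induction D generalizing f g with
  | zero =>
    rw [eq_C_of_natDegree_le_zero hgD] at h ⊢
    exact .C_right hV h
  | succ D ih =>
    wlog hf : IsUnit (f.coeff 0) generalizing f g
    · exact (this h.symm hgD hfD
        ((isUnit_coeff_zero_or_of_isCoprime h).resolve_left hf)).swap
    obtain ⟨c, -, h1, h2⟩ := MennickeTrivial.exists_divX hf h
    have hD := natDegree_divX_sub_le hgD hfD c
    refine h2 ?_
    generalize divX (g - C c * f) = p at h1 hD
    obtain ⟨k, hk, hmin⟩ := exists_forall_dvd hV (Finset.range (D + 1)) p.coeff ⟨0, by simp⟩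
    obtain ⟨q, hq⟩ : C (p.coeff k) ∣ p := (C_dvd_iff_dvd_coeff _ _).2 fun l => by
      rcases lt_or_ge l (D + 1) with hl | hl
      · exact hmin l (by simpa using hl)
      · rw [coeff_eq_zero_of_natDegree_lt (n := l) (by lia)]
        exact dvd_zero _
    obtain ⟨a, ha, haD, hac⟩ := exists_eq_C_mul_of_coeff hD (d := p.coeff k)
      (q := fun m => if m = k then 1 else q.coeff m) fun m _ => by
        split_ifs with h
        · rw [mul_one, h]
        · conv_lhs => rw [hq]
          rw [coeff_C_mul]
    have hak : a.coeff k = 1 := by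
      rw [hac k (Nat.lt_succ_iff.1 (by simpa using hk)), if_pos rfl]
    rw [ha] at h1 ⊢
    exact (MennickeTrivial.C_right hV h1.of_mul_right_left).mul_right
      (.of_isUnit_coeff (fun f g => ih) k h1.of_mul_right_right hf hfD haD (by simp [hak]))

end MennickeValuationRing

section SpecialLinear

variable {κ A V : Type} [Fintype κ] [DecidableEq κ] [CommRing A] [CommRing V]

theorem mem_Elem_of_fromBlocks_mem_Elem
    (hrow : ∀ v : κ ⊕ Unit → A, (∃ w, v ⬝ᵥ w = 1) → RowEquivE v (Pi.single (Sum.inr ()) 1))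
    (hκ : ∀ M : Matrix κ κ A, M.det = 1 →
      fromBlocks M 0 0 (1 : Matrix Unit Unit A) ∈ Elem (κ ⊕ Unit) A)
    {σ : Matrix (κ ⊕ Unit) (κ ⊕ Unit) A} (hσ : σ.det = 1) : σ ∈ Elem (κ ⊕ Unit) A := by
  obtain ⟨E, hE, h⟩ := hrow (σ (Sum.inr ())) ⟨fun l => σ.adjugate l (Sum.inr ()), by
    have := congrFun (congrFun σ.mul_adjugate (Sum.inr ())) (Sum.inr ())
    simpa [hσ, mul_apply, dotProduct] using this⟩
  refine mem_Elem_of_mul_mem_right hE ?_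
  have hτ : (σ * E).det = 1 := by rw [det_mul, hσ, det_of_mem_Elem hE, one_mul]
  have hr : ∀ l, (σ * E) (Sum.inr ()) l = (Pi.single (Sum.inr ()) 1 : κ ⊕ Unit → A) l :=
    fun l => congrFun h l
  generalize σ * E = τ at hτ hr
  have hB : τ = fromBlocks τ.toBlocks₁₁ τ.toBlocks₁₂ 0 1 := by
    ext (i | i) (j | j)
    · rfl
    · rfl
    · simp [hr]
    · simp [hr]
  have hdet : τ.toBlocks₁₁.det = 1 := by
    rw [hB, det_fromBlocks_zero₂₁, det_one, mul_one] at hτ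
    exact hτ
  have := mul_mem (one_add_vecMulVec_single_mem_Elem
    (c := Sum.elim (fun i => τ (Sum.inl i) (Sum.inr ())) 0) (j := Sum.inr ()) rfl) (hκ _ hdet)
  convert this using 1
  have h1 : (1 + vecMulVec (Sum.elim (fun i => τ (Sum.inl i) (Sum.inr ())) 0)
      (Pi.single (Sum.inr ()) 1) : Matrix (κ ⊕ Unit) (κ ⊕ Unit) A)
      = fromBlocks 1 τ.toBlocks₁₂ 0 1 := by
    ext (i | i) (j | j) <;> simp [vecMulVec_apply, one_apply, toBlocks₁₂]
  rw [h1, fromBlocks_multiply]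
  simpa using hB

theorem fromBlocks_mem_Elem_of_mennickeTrivial
    (h : ∀ f g : A, IsCoprime f g → MennickeTrivial f g) {M : Matrix (Fin 2) (Fin 2) A}
    (hM : M.det = 1) : fromBlocks M 0 0 (1 : Matrix Unit Unit A) ∈ Elem (Fin 2 ⊕ Unit) A := by
  rw [det_fin_two] at hM
  have h1 := h (M 0 0) (M 0 1) ⟨M 1 1, -M 1 0, by linear_combination hM⟩ (M 1 0) (M 1 1) hM
  convert submatrix_mem_Elem ((Equiv.sumCongr (Equiv.refl (Fin 2))
    (Equiv.ofUnique Unit (Fin 1))).trans finSumFinEquiv) h1 using 1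
  ext (i | i) (j | j)
  · fin_cases i <;> fin_cases j <;> rfl
  · fin_cases i <;> rfl
  · fin_cases j <;> rfl
  · rfl

/-- Over `V[X]`, for a local ring `V` in which divisibility is total, every matrix of determinant
one and size at least three is elementary. -/
theorem mem_Elem_of_det_eq_one [IsLocalRing V] (hV : ∀ a b : V, a ∣ b ∨ b ∣ a) {n : ℕ}
    (hn : 3 ≤ n) {σ : Matrix (Fin n) (Fin n) V[X]} (hσ : σ.det = 1) : σ ∈ Elem (Fin n) V[X] := by
  have hstep : ∀ n, 2 ≤ n → (∀ M : Matrix (Fin n) (Fin n) V[X], M.det = 1 →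
      fromBlocks M 0 0 (1 : Matrix Unit Unit V[X]) ∈ Elem (Fin n ⊕ Unit) V[X]) →
      ∀ σ : Matrix (Fin (n + 1)) (Fin (n + 1)) V[X], σ.det = 1 → σ ∈ Elem (Fin (n + 1)) V[X] := by
    intro n hn hS σ hσ
    let e : Fin n ⊕ Unit ≃ Fin (n + 1) :=
      (Equiv.sumCongr (Equiv.refl (Fin n)) (Equiv.ofUnique Unit (Fin 1))).trans finSumFinEquiv
    have hι : ∀ a b : Fin n ⊕ Unit, ∃ c, c ≠ a ∧ c ≠ b := fun a b => by
      obtain ⟨c, hc⟩ := Finset.exists_mem_notMem_of_card_lt_card (s := {a, b})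
        (t := (Finset.univ : Finset (Fin n ⊕ Unit)))
        (lt_of_le_of_lt (Finset.card_le_two (a := a) (b := b)) (by simp; lia))
      exact ⟨c, by simpa using hc⟩
    have := mem_Elem_of_fromBlocks_mem_Elem (fun v hv => by
      obtain ⟨i, hi⟩ := RowEquivE.exists_single hV hι hv
      exact hi.trans (.single_one _ _)) hS (σ := σ.submatrix e e) (by simpa using hσ)
    simpa using submatrix_mem_Elem e.symm this
  have hS : ∀ n, 2 ≤ n → ∀ M : Matrix (Fin n) (Fin n) V[X], M.det = 1 →
      fromBlocks M 0 0 (1 : Matrix Unit Unit V[X]) ∈ Elem (Fin n ⊕ Unit) V[X] := fun n hn => by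
    induction n, hn using Nat.le_induction with
    | base => exact fun M hM =>
        fromBlocks_mem_Elem_of_mennickeTrivial (fun f g h => .of_isCoprime hV h) hM
    | succ n hn ih => exact fun M hM => fromBlocks_mem_Elem (hstep n hn ih M hM)
  obtain ⟨m, rfl⟩ : ∃ m, n = m + 1 := ⟨n - 1, by lia⟩
  exact hstep m (by lia) (hS m (by lia)) σ hσ

end SpecialLinear

section Conjugation

variable {ι B : Type} [Fintype ι] [DecidableEq ι] [CommRing B]

theorem transvection_mul_transvection_neg {k l : ι} (h : k ≠ l) (a : B) :
    transvection k l a * transvection k l (-a) = 1 := by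
  rw [transvection_mul_transvection_same _ _ h, add_neg_cancel, transvection_zero]

theorem transvection_conj_of_ne {k l i j : ι} (hkl : k ≠ l) (hil : i ≠ l) (hjk : j ≠ k)
    (a b : B) :
    transvection k l a * transvection i j b * transvection k l (-a) = transvection i j b := by
  have h : transvection k l a * transvection i j b = transvection i j b * transvection k l a := by
    simp [transvection, add_mul, mul_add, hil.symm, hjk, add_comm, add_left_comm]
  rw [h, mul_assoc, transvection_mul_transvection_neg hkl, mul_one]

theorem transvection_conj_left {k l j : ι} (hkl : k ≠ l) (hlj : l ≠ j) (hkj : k ≠ j) (a b : B) :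
    transvection k l a * transvection l j b * transvection k l (-a)
      = transvection k j (a * b) * transvection l j b := by
  have h : transvection k l a * transvection l j b
      = transvection k j (a * b) * transvection l j b * transvection k l a := by
    simp only [transvection, add_mul, mul_add, one_mul, mul_one, zero_mul, single_mul_single_same,
      single_mul_single_of_ne _ _ _ _ hlj.symm, single_mul_single_of_ne _ _ _ _ hkj.symm]
    abel
  rw [h, mul_assoc, transvection_mul_transvection_neg hkl, mul_one]

theorem transvection_conj_right {k l i : ι} (hkl : k ≠ l) (hil : i ≠ l) (a b : B) :
    transvection k l a * transvection i k b * transvection k l (-a)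
      = transvection i l (-a * b) * transvection i k b := by
  have h : transvection k l a * transvection i k b
      = transvection i l (-a * b) * transvection i k b * transvection k l a := by
    simp only [transvection, add_mul, mul_add, one_mul, mul_one, zero_mul, neg_zero, single_mul_single_same,
      single_mul_single_of_ne _ _ _ _ hkl.symm, single_mul_single_of_ne _ _ _ _ hil.symm,
      neg_mul, mul_comm a b, ← single_neg]
    abel
  rw [h, mul_assoc, transvection_mul_transvection_neg hkl, mul_one]

theorem transvection_commutator {l h k : ι} (hlh : l ≠ h) (hhk : h ≠ k) (hlk : l ≠ k) (x y : B) :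
    transvection l h x * transvection h k y * transvection l h (-x) * transvection h k (-y)
      = transvection l k (x * y) := by
  rw [transvection_conj_left hlh hhk hlk, mul_assoc, transvection_mul_transvection_neg hhk, mul_one]

theorem conj_mul_conj {e e' : Matrix ι ι B} (h : e' * e = 1) (x y : Matrix ι ι B) :
    e * x * e' * (e * y * e') = e * (x * y) * e' := by
  simp only [mul_assoc]
  rw [← mul_assoc e' e, h, one_mul]

end Conjugation

section Dilation

variable {ι A L : Type} [Fintype ι] [DecidableEq ι] [CommRing A] [CommRing L]

/-- The monoid generated by the elementary matrices whose off-diagonal entry is the image of a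
multiple of `s`. -/
noncomputable def ElemMultiple (ι : Type) {A L : Type} [Fintype ι] [DecidableEq ι] [CommRing A] [CommRing L]
    (φ : A →+* L) (s : A) : Submonoid (Matrix ι ι L[X]) :=
  Submonoid.closure
    {M | ∃ i j : ι, i ≠ j ∧ ∃ f : A[X], M = transvection i j ((C s * f).map φ)}

theorem transvection_mem_ElemMultiple {φ : A →+* L} {s : A} {i j : ι} (h : i ≠ j) {a : L[X]}
    {f : A[X]} (ha : a = (C s * f).map φ) : transvection i j a ∈ ElemMultiple ι φ s :=
  Submonoid.subset_closure ⟨i, j, h, f, by rw [ha]⟩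

theorem ElemMultiple.exists_mem_Elem {φ : A →+* L} {s : A} {M : Matrix ι ι L[X]}
    (hM : M ∈ ElemMultiple ι φ s) : ∃ E ∈ Elem ι A[X], M = E.map (mapRingHom φ) := by
  induction hM using Submonoid.closure_induction with
  | mem x hx =>
    obtain ⟨i, j, h, f, rfl⟩ := hx
    exact ⟨_, transvection_mem_Elem h (C s * f), by rw [map_transvection]; rfl⟩
  | one => exact ⟨1, one_mem _, by rw [Matrix.map_one _ (map_zero _) (map_one _)]⟩
  | mul x y _ _ hx hy =>
    obtain ⟨E, hE, rfl⟩ := hx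
    obtain ⟨F, hF, rfl⟩ := hy
    exact ⟨E * F, mul_mem hE hF, by rw [Matrix.map_mul]⟩

theorem ElemMultiple.conj_transvection_mem {φ : A →+* L} {s t : A} {a : L[X]} {c : A[X]}
    (hc : C (φ t) * a = c.map φ) {k l i j : ι} (hkl : k ≠ l) (hij : i ≠ j)
    (h : ¬(i = l ∧ j = k)) {b : L[X]} {f : A[X]} (hb : b = (C (s * t) * f).map φ) :
    transvection k l a * transvection i j b * transvection k l (-a) ∈ ElemMultiple ι φ s := by
  have hab : a * b = (C s * (c * f)).map φ := by
    rw [hb]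
    simp only [Polynomial.map_mul, map_C, map_mul, ← hc]
    ring
  have hb' : b = (C s * (C t * f)).map φ := by rw [hb, C_mul, mul_assoc]
  rcases eq_or_ne i l with rfl | hil
  · have hjk : j ≠ k := fun hjk => h ⟨rfl, hjk⟩
    rw [transvection_conj_left hkl hij hjk.symm]
    exact mul_mem (transvection_mem_ElemMultiple hjk.symm hab)
      (transvection_mem_ElemMultiple hij hb')
  rcases eq_or_ne j k with rfl | hjk
  · rw [transvection_conj_right hkl hil]
    refine mul_mem (transvection_mem_ElemMultiple hil (f := -(c * f)) ?_)
      (transvection_mem_ElemMultiple hij hb')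
    rw [neg_mul, hab, mul_neg, Polynomial.map_neg]
  · rw [transvection_conj_of_ne hkl hil hjk]
    exact transvection_mem_ElemMultiple hij hb'

theorem ElemMultiple.conj_mem {φ : A →+* L} {s t : A} {a : L[X]} {c : A[X]}
    (hc : C (φ t) * a = c.map φ) (hι : ∀ a b : ι, ∃ c, c ≠ a ∧ c ≠ b) {k l : ι} (hkl : k ≠ l)
    {M : Matrix ι ι L[X]} (hM : M ∈ ElemMultiple ι φ (s * t * (s * t))) :
    transvection k l a * M * transvection k l (-a) ∈ ElemMultiple ι φ s := by
  have hinv : transvection k l (-a) * transvection k l a = 1 := by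
    simpa using transvection_mul_transvection_neg hkl (-a)
  induction hM using Submonoid.closure_induction with
  | mem x hx =>
    obtain ⟨i, j, hij, f, rfl⟩ := hx
    by_cases h : i = l ∧ j = k
    · obtain ⟨rfl, rfl⟩ := h
      obtain ⟨m, hmi, hmj⟩ := hι i j
      have hprod : (C (s * t * (s * t)) * f).map φ
          = (C (s * t) * 1).map φ * (C (s * t) * f).map φ := by
        rw [← Polynomial.map_mul]
        congr 1
        rw [C_mul]
        ring
      rw [hprod, ← transvection_commutator hmi.symm hmj hij, ← conj_mul_conj hinv,
        ← conj_mul_conj hinv, ← conj_mul_conj hinv]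
      refine mul_mem (mul_mem (mul_mem ?_ ?_) ?_) ?_
      · exact conj_transvection_mem hc hkl hmi.symm (fun h => hmj h.2) rfl
      · exact conj_transvection_mem hc hkl hmj (fun h => hmi h.1) rfl
      · exact conj_transvection_mem hc hkl hmi.symm (fun h => hmj h.2) (f := -1) (by simp)
      · exact conj_transvection_mem hc hkl hmj (fun h => hmi h.1) (f := -f) (by simp)
    · refine conj_transvection_mem hc hkl hij h (f := C (s * t) * f) ?_
      rw [C_mul (a := s * t), mul_assoc]
  | one =>
    rw [mul_one, transvection_mul_transvection_neg hkl]
    exact one_mem _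
  | mul x y _ _ hx hy =>
    rw [← conj_mul_conj hinv]
    exact mul_mem hx hy

/-- The substitution `X ↦ r X`. -/
noncomputable def dilate (r : A) : A[X] →+* A[X] := compRingHom (C r * X)

theorem coeff_dilate (r : A) (p : A[X]) (n : ℕ) : (dilate r p).coeff n = p.coeff n * r ^ n := by
  simp [dilate]

theorem dilate_mul (r s : A) (p : A[X]) : dilate (r * s) p = dilate s (dilate r p) := by
  ext n
  simp only [coeff_dilate, mul_pow, mul_assoc]

theorem map_dilate (φ : A →+* L) (r : A) (p : A[X]) :
    (dilate r p).map φ = dilate (φ r) (p.map φ) := by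
  ext n
  simp [coeff_dilate]

theorem dilate_C (r a : A) : dilate r (C a) = C a := by simp [dilate]

theorem dilate_X (r : A) : dilate r X = C r * X := by simp [dilate]

/-- A matrix over `L[X]` with value one at zero which, after suitable dilations, becomes a product
of elementary matrices coming from multiples of any prescribed element of `S`. -/
def IsDilatable (S : Submonoid A) (φ : A →+* L) (η : Matrix ι ι L[X]) : Prop :=
  η.map (evalRingHom 0) = 1 ∧
    ∀ s ∈ S, ∃ s' ∈ S, ∀ r ∈ S, η.map (dilate (φ (s' * r))) ∈ ElemMultiple ι φ s

theorem IsDilatable.one (S : Submonoid A) (φ : A →+* L) :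
    IsDilatable S φ (1 : Matrix ι ι L[X]) := by
  refine ⟨Matrix.map_one _ (map_zero _) (map_one _), fun s _ => ⟨1, one_mem _, fun r _ => ?_⟩⟩
  rw [Matrix.map_one _ (map_zero _) (map_one _)]
  exact one_mem _

theorem IsDilatable.mul {S : Submonoid A} {φ : A →+* L} {η θ : Matrix ι ι L[X]}
    (hη : IsDilatable S φ η) (hθ : IsDilatable S φ θ) : IsDilatable S φ (η * θ) := by
  refine ⟨by rw [Matrix.map_mul, hη.1, hθ.1, one_mul], fun s hs => ?_⟩
  obtain ⟨s₁, hs₁, h₁⟩ := hη.2 s hs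
  obtain ⟨s₂, hs₂, h₂⟩ := hθ.2 s hs
  refine ⟨s₁ * s₂, mul_mem hs₁ hs₂, fun r hr => ?_⟩
  rw [Matrix.map_mul]
  refine mul_mem ?_ ?_
  · rw [mul_assoc]
    exact h₁ _ (mul_mem hs₂ hr)
  · rw [mul_comm s₁, mul_assoc]
    exact h₂ _ (mul_mem hs₁ hr)

theorem IsDilatable.transvection_X_mul {S : Submonoid A} {φ : A →+* L}
    (hφ : ∀ a : L[X], ∃ t ∈ S, ∃ f : A[X], C (φ t) * a = f.map φ) {i j : ι} (hij : i ≠ j)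
    (h : L[X]) : IsDilatable S φ (transvection i j (X * h)) := by
  refine ⟨by rw [map_transvection, map_mul, coe_evalRingHom, eval_X, zero_mul, transvection_zero],
    fun s hs => ?_⟩
  obtain ⟨t, ht, c, hc⟩ := hφ h
  refine ⟨s * t, mul_mem hs ht, fun r _ => ?_⟩
  rw [map_transvection]
  refine transvection_mem_ElemMultiple hij (f := C r * X * dilate (s * t * r) c) ?_
  have := congrArg (dilate (φ (s * t * r))) hc
  rw [map_mul, dilate_C] at this
  rw [map_mul, dilate_X, Polynomial.map_mul, Polynomial.map_mul, map_dilate, ← this]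
  simp only [map_mul, Polynomial.map_mul, map_C, map_X]
  ring

theorem IsDilatable.conj {S : Submonoid A} {φ : A →+* L}
    (hφ : ∀ a : L[X], ∃ t ∈ S, ∃ f : A[X], C (φ t) * a = f.map φ)
    (hι : ∀ a b : ι, ∃ c, c ≠ a ∧ c ≠ b) {k l : ι} (hkl : k ≠ l) (a : L) {η : Matrix ι ι L[X]}
    (hη : IsDilatable S φ η) :
    IsDilatable S φ (transvection k l (C a) * η * transvection k l (-C a)) := by
  refine ⟨?_, fun s hs => ?_⟩
  · rw [Matrix.map_mul, Matrix.map_mul, hη.1, mul_one, map_transvection, map_transvection, map_neg,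
      transvection_mul_transvection_neg hkl]
  · obtain ⟨t, ht, c, hc⟩ := hφ (C a)
    obtain ⟨s', hs', h⟩ := hη.2 (s * t * (s * t)) (mul_mem (mul_mem hs ht) (mul_mem hs ht))
    refine ⟨s', hs', fun r hr => ?_⟩
    rw [Matrix.map_mul, Matrix.map_mul, map_transvection, map_transvection, map_neg, dilate_C]
    exact ElemMultiple.conj_mem hc hι hkl (h r hr)

theorem exists_isDilatable_mul {S : Submonoid A} {φ : A →+* L}
    (hφ : ∀ a : L[X], ∃ t ∈ S, ∃ f : A[X], C (φ t) * a = f.map φ)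
    (hι : ∀ a b : ι, ∃ c, c ≠ a ∧ c ≠ b) {ε : Matrix ι ι L[X]} (hε : ε ∈ Elem ι L[X]) :
    ∃ η, IsDilatable S φ η ∧ ∃ γ : Matrix ι ι L, ε = η * γ.map C := by
  induction hε using Submonoid.closure_induction_left with
  | one => exact ⟨1, .one S φ, 1, by simp [Matrix.map_one]⟩
  | mul_left x hx y _ ih =>
    obtain ⟨i, j, f, hij, rfl⟩ := hx
    obtain ⟨η, hη, γ, rfl⟩ := ih
    refine ⟨_, (IsDilatable.transvection_X_mul hφ hij (divX f)).mul
      (hη.conj hφ hι hij (f.coeff 0)), transvection i j (f.coeff 0) * γ, ?_⟩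
    have h1 : transvection i j f = transvection i j (X * divX f) * transvection i j (C (f.coeff 0))
        := by
      rw [transvection_mul_transvection_same _ _ hij, X_mul_divX_add]
    have h2 : transvection i j (-C (f.coeff 0)) * transvection i j (C (f.coeff 0)) = 1 := by
      simpa using transvection_mul_transvection_neg hij (-C (f.coeff 0))
    rw [h1, Matrix.map_mul, map_transvection]
    simp only [mul_assoc]
    rw [← mul_assoc (transvection i j (-C (f.coeff 0))), h2, one_mul]

/-- An elementary matrix over `L[X]` with value one at zero descends to `A[X]` after a dilation. -/
theorem exists_map_eq_dilate {S : Submonoid A} {φ : A →+* L}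
    (hφ : ∀ a : L[X], ∃ t ∈ S, ∃ f : A[X], C (φ t) * a = f.map φ)
    (hι : ∀ a b : ι, ∃ c, c ≠ a ∧ c ≠ b) {ε : Matrix ι ι L[X]} (hε : ε ∈ Elem ι L[X])
    (h0 : ε.map (evalRingHom 0) = 1) :
    ∃ s ∈ S, ∃ τ ∈ Elem ι A[X], ε.map (dilate (φ s)) = τ.map (mapRingHom φ) := by
  obtain ⟨η, hη, γ, rfl⟩ := exists_isDilatable_mul hφ hι hε
  have hγ : γ = 1 := by
    rw [Matrix.map_mul, hη.1, one_mul, Matrix.map_map] at h0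
    rw [← h0]
    ext i j
    simp
  obtain ⟨s, hs, h⟩ := hη.2 1 (one_mem S)
  have := h 1 (one_mem S)
  rw [mul_one] at this
  refine ⟨s, hs, ?_⟩
  rw [hγ, Matrix.map_one _ C_0 C_1, mul_one]
  exact ElemMultiple.exists_mem_Elem this

theorem exists_dilate_mem_Elem {S : Submonoid A} {φ : A →+* L}
    (hφ : ∀ a : L[X], ∃ t ∈ S, ∃ f : A[X], C (φ t) * a = f.map φ)
    (hker : ∀ f : A[X], f.map φ = 0 → ∃ t ∈ S, C t * f = 0)
    (hι : ∀ a b : ι, ∃ c, c ≠ a ∧ c ≠ b) {D : Matrix ι ι A[X]}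
    (hD : D.map (mapRingHom φ) ∈ Elem ι L[X]) (h0 : D.map (evalRingHom 0) = 1) :
    ∃ s ∈ S, D.map (dilate s) ∈ Elem ι A[X] := by
  have hD0 : (D.map (mapRingHom φ)).map (evalRingHom 0) = 1 := by
    rw [← Matrix.map_one φ φ.map_zero φ.map_one, ← h0]
    ext i j
    simp [← coeff_zero_eq_eval_zero]
  obtain ⟨s, hs, τ, hτ, h⟩ := exists_map_eq_dilate hφ hι hD hD0
  have hτ0 : (τ.map (evalRingHom 0)).map φ = 1 := by
    rw [← hD0]
    ext i j
    have := congrArg (fun p => p.coeff 0) (congrFun (congrFun h i) j)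
    simp only [Matrix.map_apply, coeff_dilate, pow_zero, mul_one, coe_mapRingHom,
      coeff_map] at this
    simp [← coeff_zero_eq_eval_zero, this]
  have hτ0' := map_mem_Elem (evalRingHom 0) hτ
  have hθ := mul_mem hτ (map_mem_Elem C (adjugate_mem_Elem hτ0'))
  have hθ0 : (τ * ((τ.map (evalRingHom 0)).adjugate).map C).map (evalRingHom 0) = 1 := by
    have : ∀ M : Matrix ι ι A, (M.map C).map (evalRingHom 0) = M := fun M => by ext i j; simp
    rw [Matrix.map_mul, this, mul_adjugate, det_of_mem_Elem hτ0', one_smul]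
  have hθφ : (τ * ((τ.map (evalRingHom 0)).adjugate).map C).map (mapRingHom φ)
      = (D.map (dilate s)).map (mapRingHom φ) := by
    have h1 : ∀ M : Matrix ι ι A, (M.map C).map (mapRingHom φ) = (M.map φ).map C := fun M => by
      ext i j : 2; simp
    have h2 : (τ.map (evalRingHom 0)).adjugate.map φ = 1 := by
      have := φ.map_adjugate (τ.map (evalRingHom 0))
      rw [RingHom.mapMatrix_apply, RingHom.mapMatrix_apply, hτ0, adjugate_one] at this
      exact this
    rw [Matrix.map_mul, h1, h2, Matrix.map_one _ C_0 C_1, mul_one, ← h]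
    ext i j : 2
    simp [map_dilate]
  generalize τ * ((τ.map (evalRingHom 0)).adjugate).map C = θ at hθ hθ0 hθφ
  have hsub : ∀ i j, ∃ t ∈ S, C t * (dilate s (D i j) - θ i j) = 0 := fun i j => by
    refine hker _ ?_
    have := congrFun (congrFun hθφ i) j
    simp only [Matrix.map_apply, coe_mapRingHom] at this
    rw [Polynomial.map_sub, this, sub_self]
  choose t ht htD using hsub
  refine ⟨s * ∏ i, ∏ j, t i j, mul_mem hs (prod_mem fun i _ => prod_mem fun j _ => ht i j), ?_⟩
  convert map_mem_Elem (dilate (∏ i, ∏ j, t i j)) hθ using 1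
  refine Matrix.ext fun i j => ?_
  rw [Matrix.map_apply, Matrix.map_apply, dilate_mul, ← sub_eq_zero, ← map_sub]
  have htT : t i j ∣ ∏ i, ∏ j, t i j :=
    (Finset.dvd_prod_of_mem (fun j => t i j) (Finset.mem_univ j)).trans
      (Finset.dvd_prod_of_mem (fun i => ∏ j, t i j) (Finset.mem_univ i))
  obtain ⟨e, he⟩ := htT
  ext n
  rw [coeff_dilate, coeff_zero, he]
  cases n with
  | zero =>
    have h1 := congrFun (congrFun h0 i) j
    have h2 := congrFun (congrFun hθ0 i) j
    simp only [Matrix.map_apply, coe_evalRingHom, ← coeff_zero_eq_eval_zero] at h1 h2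
    rw [coeff_sub, coeff_dilate, h1, h2]
    simp
  | succ n =>
    have := congrArg (fun p => p.coeff (n + 1)) (htD i j)
    simp only [coeff_C_mul, coeff_zero] at this
    linear_combination e * (t i j * e) ^ n * this

end Dilation

section LocalGlobal

variable {ι R V : Type} [Fintype ι] [DecidableEq ι] [CommRing R] [CommRing V]

theorem exists_C_mul_eq_map (S : Submonoid R) [Algebra R V] [IsLocalization S V] (a : V[X]) :
    ∃ t ∈ S, ∃ f : R[X], C (algebraMap R V t) * a = f.map (algebraMap R V) := by
  let := Polynomial.algebra R V
  have := Polynomial.isLocalization S V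
  obtain ⟨⟨f, ⟨_, t, ht, rfl⟩⟩, h⟩ := IsLocalization.surj (S.map C) a
  rw [Polynomial.algebraMap_def] at h
  refine ⟨t, ht, f, ?_⟩
  simpa [mul_comm] using h

theorem exists_C_mul_eq_zero (S : Submonoid R) [Algebra R V] [IsLocalization S V] {f : R[X]}
    (hf : f.map (algebraMap R V) = 0) : ∃ t ∈ S, C t * f = 0 := by
  let := Polynomial.algebra R V
  have := Polynomial.isLocalization S V
  obtain ⟨⟨_, t, ht, rfl⟩, h⟩ := (IsLocalization.map_eq_zero_iff (S.map C) V[X] f).1 hf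
  exact ⟨t, ht, h⟩

/-- The substitution `X ↦ Y + Z`, with values in `R[Y][Z]`. -/
noncomputable def addSubst (R : Type) [CommRing R] : R[X] →+* R[X][X] :=
  eval₂RingHom (C.comp C) (C X + X)

theorem addSubst_map (f : R →+* V) (p : R[X]) :
    (addSubst R p).map (mapRingHom f) = addSubst V (p.map f) := by
  have : (mapRingHom (mapRingHom f)).comp (addSubst R) = (addSubst V).comp (mapRingHom f) := by
    ext a : 2 <;> simp [addSubst]
  exact congrArg (fun g => g p) this

theorem eval₂_addSubst (q h p : R[X]) :
    eval₂ (compRingHom q) h (addSubst R p) = p.comp (q + h) := by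
  have : (eval₂RingHom (compRingHom q) h).comp (addSubst R) = compRingHom (q + h) := by
    ext a : 2 <;> simp [addSubst]
  exact congrArg (fun g => g p) this

theorem eval_zero_addSubst (p : R[X]) : (addSubst R p).eval 0 = p := by
  have : (evalRingHom 0).comp (addSubst R) = RingHom.id R[X] := by
    ext a : 2 <;> simp [addSubst]
  exact congrArg (fun g => g p) this

theorem eval₂_dilate_C (q h : R[X]) (s : R) (p : R[X][X]) :
    eval₂ (compRingHom q) h (dilate (C s) p) = eval₂ (compRingHom q) (C s * h) p := by
  have : (eval₂RingHom (compRingHom q) h).comp (dilate (C s))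
      = eval₂RingHom (compRingHom q) (C s * h) := by
    refine Polynomial.ringHom_ext (fun a => ?_) ?_ <;> simp [dilate_C, dilate_X]
  exact congrArg (fun g => g p) this

theorem adjugate_map (f : R →+* V) (M : Matrix ι ι R) : M.adjugate.map f = (M.map f).adjugate :=
  f.map_adjugate M

theorem exists_adjugate_mul_mem_Elem (S : Submonoid R) [Algebra R V] [IsLocalization S V]
    (hι : ∀ a b : ι, ∃ c, c ≠ a ∧ c ≠ b) {σ : Matrix ι ι R[X]} (hσ : σ.det = 1)
    (hV : σ.map (mapRingHom (algebraMap R V)) ∈ Elem ι V[X]) :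
    ∃ s ∈ S, ∀ q h : R[X],
      (σ.map (compRingHom q)).adjugate * σ.map (compRingHom (q + C s * h)) ∈ Elem ι R[X] := by
  let := Polynomial.algebra R V
  have := Polynomial.isLocalization S V
  obtain ⟨_, ⟨s, hs, rfl⟩, hsD⟩ := exists_dilate_mem_Elem (S := S.map C)
    (φ := algebraMap R[X] V[X]) (exists_C_mul_eq_map _) (fun f hf => exists_C_mul_eq_zero _ hf) hι
    (D := (σ.map C).adjugate * σ.map (addSubst R))
    (by
      rw [Polynomial.algebraMap_def, Matrix.map_mul, adjugate_map]
      have h1 : (σ.map C).map (mapRingHom (mapRingHom (algebraMap R V)))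
          = (σ.map (mapRingHom (algebraMap R V))).map C :=
        Matrix.ext fun i j => by simp
      have h2 : (σ.map (addSubst R)).map (mapRingHom (mapRingHom (algebraMap R V)))
          = (σ.map (mapRingHom (algebraMap R V))).map (addSubst V) :=
        Matrix.ext fun i j => by simp [addSubst_map]
      rw [h1, h2]
      exact mul_mem (adjugate_mem_Elem (map_mem_Elem _ hV)) (map_mem_Elem _ hV))
    (by
      rw [Matrix.map_mul, adjugate_map]
      have h1 : (σ.map C).map (evalRingHom 0) = σ := Matrix.ext fun i j => by simp
      have h2 : (σ.map (addSubst R)).map (evalRingHom 0) = σ :=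
        Matrix.ext fun i j => by simp [eval_zero_addSubst]
      rw [h1, h2, adjugate_mul, hσ, one_smul])
  refine ⟨s, hs, fun q h => ?_⟩
  convert map_mem_Elem (eval₂RingHom (compRingHom q) h) hsD using 1
  have h0 : ((σ.map C).adjugate * σ.map (addSubst R)).map (dilate (C s))
      = ((σ.map C).map (dilate (C s))).adjugate * (σ.map (addSubst R)).map (dilate (C s)) := by
    rw [Matrix.map_mul, adjugate_map]
  have h1 : ((σ.map C).map (dilate (C s))).map (eval₂RingHom (compRingHom q) h)
      = σ.map (compRingHom q) := Matrix.ext fun i j => by simp [dilate_C]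
  have h2 : ((σ.map (addSubst R)).map (dilate (C s))).map (eval₂RingHom (compRingHom q) h)
      = σ.map (compRingHom (q + C s * h)) :=
    Matrix.ext fun i j => by simp [eval₂_dilate_C, eval₂_addSubst]
  exact (by rw [h0, Matrix.map_mul, adjugate_map, h1, h2])

/-- A matrix of determinant one over `R[X]` which is elementary over `R_m[X]` for every maximal
ideal `m` is congruent to its value at zero modulo elementary matrices. -/
theorem exists_mul_eq_map_eval_zero (hι : ∀ a b : ι, ∃ c, c ≠ a ∧ c ≠ b) {σ : Matrix ι ι R[X]}
    (hσ : σ.det = 1)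
    (hloc : ∀ (m : Ideal R) [m.IsMaximal],
      σ.map (mapRingHom (algebraMap R (Localization.AtPrime m))) ∈
        Elem ι (Localization.AtPrime m)[X]) :
    ∃ E ∈ Elem ι R[X], σ * E = σ.map fun p => C (p.eval 0) := by
  have hdet : ∀ q : R[X], (σ.map (compRingHom q)).det = 1 := fun q => by
    rw [← RingHom.mapMatrix_apply, ← RingHom.map_det, hσ, map_one]
  let Q : Ideal R :=
    { carrier := {s | ∀ q h : R[X],
        (σ.map (compRingHom q)).adjugate * σ.map (compRingHom (q + C s * h)) ∈ Elem ι R[X]}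
      zero_mem' := fun q h => by
        rw [C_0, zero_mul, add_zero, adjugate_mul, hdet, one_smul]
        exact one_mem _
      add_mem' := fun {s t} hs ht q h => by
        have := mul_mem (hs q h) (ht (q + C s * h) h)
        rw [mul_assoc, ← mul_assoc _ (adjugate _), mul_adjugate, hdet, one_smul, one_mul] at this
        rwa [C_add, add_mul, ← add_assoc]
      smul_mem' := fun r s hs q h => by
        have := hs q (C r * h)
        rwa [smul_eq_mul, mul_comm r, C_mul, mul_assoc] }
  have hQ : Q = ⊤ := by
    by_contra hne
    obtain ⟨m, hm, hQm⟩ := Ideal.exists_le_maximal Q hne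
    obtain ⟨s, hs, h⟩ := exists_adjugate_mul_mem_Elem m.primeCompl hι hσ (hloc m)
    exact hs (hQm h)
  have h1 : (1 : R) ∈ Q := hQ ▸ Submodule.mem_top
  refine ⟨_, h1 X (-X), ?_⟩
  have hX : σ.map (compRingHom X) = σ := Matrix.ext fun i j => by simp
  rw [hX, ← mul_assoc, mul_adjugate, hσ, one_smul, one_mul]
  refine Matrix.ext fun i j => ?_
  simp

end LocalGlobal

theorem stmt_16 {R : Type} [CommRing R]
    (hR : ∀ (m : Ideal R) (hm : m.IsMaximal),
      ∀ a b : @Localization.AtPrime R _ m hm.isPrime, a ∣ b ∨ b ∣ a)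
    (n : ℕ) (hn : 3 ≤ n) (σ : Matrix (Fin n) (Fin n) R[X]) (hσ : σ.det = 1) :
    ∃ E ∈ Elem (Fin n) R[X], σ * E = σ.map (fun p => C (p.eval 0)) := by
  have hι : ∀ a b : Fin n, ∃ c, c ≠ a ∧ c ≠ b := fun a b => by
    obtain ⟨c, hc⟩ := Finset.exists_mem_notMem_of_card_lt_card (s := {a, b})
      (t := (Finset.univ : Finset (Fin n)))
      (lt_of_le_of_lt (Finset.card_le_two (a := a) (b := b)) (by simp; lia))
    exact ⟨c, by simpa using hc⟩
  refine exists_mul_eq_map_eval_zero hι hσ fun m hm => ?_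
  refine mem_Elem_of_det_eq_one (hR m hm) hn ?_
  rw [← RingHom.mapMatrix_apply, ← RingHom.map_det, hσ, map_one]
end
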